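/- Let k,c≥1 and z=c(c(k²+k+1)+k+2). Let (G,s_1,t_1,…,s_k,t_k) be a problem instance where G has a clique-partition (C_1,…,C_c), and let L=(P_1,…,P_k) be a minimum linkage for it. Then there is an enumeration (v_1,…,v_n) of V(L)∖{s_1,…,s_k,t_1,…,t_k} such that for every h with 0≤h≤n, if B denotes {s_1,…,s_k}∪{v_i : 1≤i≤h} and A=V(L)∖B, then: for 1≤a≤c the set B∩C_a is C_a-acceptable for L, and the (B,A)-wiggle number of each member of L is at most c(c−1)(z+1)+1. -/

import Mathlib

open scoped Classical

noncomputable section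

/-- A digraph: loopless, no parallel edges (an adjacency relation);
for distinct `u v` both `adj u v` and `adj v u` may hold. -/
structure Dgraph (V : Type) where
  adj : V → V → Prop
  irrefl : ∀ v, ¬ adj v v

/-- A directed path in a digraph `G`, given by its (nonempty, duplicate-free) list of
vertices, consecutive vertices being adjacent. -/
structure Dpath {V : Type} (G : Dgraph V) where
  verts : List V
  ne : verts ≠ []
  nodup : verts.Nodup
  chain : verts.Chain' G.adj

namespace Dpath

variable {V : Type} {G : Dgraph V}

/-- `s(P)`, the first vertex of a path. -/
def first (P : Dpath G) : V := P.verts.head P.ne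

/-- `t(P)`, the last vertex of a path. -/
def last (P : Dpath G) : V := P.verts.getLast P.ne

/-- `V(P)`, the set of vertices of a path. -/
def support (P : Dpath G) : Set V := {v | v ∈ P.verts}

/-- The length of a path: its number of edges. -/
def length (P : Dpath G) : ℕ := P.verts.length - 1

/-- `Q` is a subpath of `P`. -/
def IsSubpath (Q P : Dpath G) : Prop := Q.verts <:+: P.verts

/-- `Q` is an initial subpath of `P` (a subpath with `s(Q) = s(P)`). -/
def IsInitialSubpath (Q P : Dpath G) : Prop := Q.verts <+: P.verts

/-- The (directed) edges of a path, as ordered pairs of consecutive vertices. -/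
def edges (P : Dpath G) : List (V × V) := P.verts.zip P.verts.tail

end Dpath

variable {V : Type}

/-- A family of paths is a linkage when its members are pairwise vertex-disjoint. -/
def IsLinkage {G : Dgraph V} {k : ℕ} (L : Fin k → Dpath G) : Prop :=
  ∀ i j, i ≠ j → Disjoint (L i).support (L j).support

/-- `V(L)`, the union of the vertex sets of the members of a linkage. -/
def linkSupport {G : Dgraph V} {k : ℕ} (L : Fin k → Dpath G) : Set V :=
  ⋃ i, (L i).support

/-- `(G, s 1, t 1, …, s k, t k)` is a problem instance: the `2k` vertices are distinct. -/
def IsInstance {k : ℕ} (sv tv : Fin k → V) : Prop :=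
  Function.Injective sv ∧ Function.Injective tv ∧ ∀ i j, sv i ≠ tv j

/-- `L` is a linkage for the problem instance: its `i`-th member runs from `s i` to `t i`. -/
def IsLinkageFor {G : Dgraph V} {k : ℕ} (L : Fin k → Dpath G) (sv tv : Fin k → V) : Prop :=
  IsLinkage L ∧ ∀ i, (L i).first = sv i ∧ (L i).last = tv i

/-- A linkage is minimum if no linkage joining the same pairs of ends uses fewer vertices. -/
def IsMinimumLinkage {G : Dgraph V} {k : ℕ} (L : Fin k → Dpath G) : Prop :=
  IsLinkage L ∧ ∀ L' : Fin k → Dpath G, IsLinkage L' →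
    (∀ i, (L' i).first = (L i).first ∧ (L' i).last = (L i).last) →
    (linkSupport L).ncard ≤ (linkSupport L').ncard

/-- A minimum linkage for a problem instance. -/
def IsMinimumLinkageFor {G : Dgraph V} {k : ℕ} (L : Fin k → Dpath G)
    (sv tv : Fin k → V) : Prop :=
  IsLinkageFor L sv tv ∧ IsMinimumLinkage L

/-- `C ⊆ V(G)` is a clique if `G[C]` is semicomplete. -/
def Dgraph.IsClique (G : Dgraph V) (C : Set V) : Prop :=
  ∀ u ∈ C, ∀ v ∈ C, u ≠ v → (G.adj u v ∨ G.adj v u)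

/-- `(C 1, …, C c)` is a clique-partition of `G`: a partition of `V(G)` into
(possibly empty) cliques. -/
def Dgraph.IsCliquePartition (G : Dgraph V) {c : ℕ} (C : Fin c → Set V) : Prop :=
  (∀ a, G.IsClique (C a)) ∧ ∀ v : V, ∃! a, v ∈ C a

/-- The internal vertices of a linkage: vertices of `V(L)` not an end of any member. -/
def internalVerts {G : Dgraph V} {k : ℕ} (L : Fin k → Dpath G) : Set V :=
  linkSupport L \ ((Set.range fun i => (L i).first) ∪ (Set.range fun i => (L i).last))

/-- `M` is internally disjoint from `L`: no internal vertex of `M` belongs to `V(L)`. -/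
def InternallyDisjointFrom {G : Dgraph V} {m k : ℕ} (M : Fin m → Dpath G)
    (L : Fin k → Dpath G) : Prop :=
  ∀ v ∈ internalVerts M, v ∉ linkSupport L

/-- A planar `(Q,R)`-matching of cardinality `n`: a linkage of `n` paths, each with at most
three vertices, whose first vertices lie on `Q` in order and last vertices lie on `R` in
order. -/
def IsPlanarMatching {G : Dgraph V} {n : ℕ} (Q R : Dpath G) (M : Fin n → Dpath G) : Prop :=
  IsLinkage M ∧ (∀ j, (M j).verts.length ≤ 3) ∧
  (List.ofFn fun j => (M j).first).Sublist Q.verts ∧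
  (List.ofFn fun j => (M j).last).Sublist R.verts

/-- A planar `(Q,R)`-matching from `X` to `Y`. -/
def IsPlanarMatchingFromTo {G : Dgraph V} {n : ℕ} (Q R : Dpath G) (M : Fin n → Dpath G)
    (X Y : Set V) : Prop :=
  IsPlanarMatching Q R M ∧ ∀ j, (M j).first ∈ X ∧ (M j).last ∈ Y

/-- `B ⊆ C` is `C`-acceptable for the linkage `L` (for the instance given by `sv, tv`). -/
def CAcceptable {G : Dgraph V} {k : ℕ} (sv tv : Fin k → V) (L : Fin k → Dpath G)
    (C B : Set V) : Prop :=
  B ⊆ C ∧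
  Set.range sv ∩ C ⊆ B ∧
  Set.range tv ∩ B = ∅ ∧
  (∀ i, ∃ Q : Dpath G, Q.IsInitialSubpath (L i) ∧ Q.support ∩ C = (L i).support ∩ B) ∧
  ∀ i j : Fin k, ¬ ∃ M : Fin (k ^ 2 + k + 2) → Dpath G,
      IsPlanarMatchingFromTo (L i) (L j) M B (C \ B) ∧ InternallyDisjointFrom M L

/-- A list of vertices is `(X,Y)`-alternating: entries with even position (0-based) are
in `X`, those with odd position in `Y`. -/
def Alternating (X Y : Set V) (l : List V) : Prop :=
  ∀ (i : ℕ) (h : i < l.length),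
    if i % 2 = 0 then l.get ⟨i, h⟩ ∈ X else l.get ⟨i, h⟩ ∈ Y

/-- `P` contains an `(X,Y)`-alternating sequence (of distinct vertices, in order in `P`)
of length `2 * m`. -/
def HasAlt {G : Dgraph V} (P : Dpath G) (X Y : Set V) (m : ℕ) : Prop :=
  ∃ l : List V, l.Sublist P.verts ∧ l.length = 2 * m ∧ Alternating X Y l

/-- The `(X,Y)`-wiggle number of `P`: half the length of the longest `(X,Y)`-alternating
sequence of vertices in order in `P`. -/
def wiggle {G : Dgraph V} (P : Dpath G) (X Y : Set V) : ℕ :=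
  sSup {m | HasAlt P X Y m}

/-- `zOf k c = c(c(k²+k+1)+k+2)`. -/
def zOf (k c : ℕ) : ℕ := c * (c * (k ^ 2 + k + 1) + k + 2)

/-- `wOf k c = c(c−1)(z+1)+1`. -/
def wOf (k c : ℕ) : ℕ := c * (c - 1) * (zOf k c + 1) + 1

/-- `rOf k c = ckw`. -/
def rOf (k c : ℕ) : ℕ := c * k * wOf k c

/-- `sOf k = k²+k+3`. -/
def sOf (k : ℕ) : ℕ := k ^ 2 + k + 3

/-- `tOf k c = 2cskw + c(2w+1)k²(k²+k+1)`. -/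
def tOf (k c : ℕ) : ℕ :=
  2 * c * sOf k * k * wOf k c + c * (2 * wOf k c + 1) * k ^ 2 * (k ^ 2 + k + 1)

/-- Given a clique-partition `C` and a linkage `L` for the instance, `B` is acceptable
(with `A = V(G) ∖ B`). -/
def Acceptable {G : Dgraph V} {k c : ℕ} (sv tv : Fin k → V) (L : Fin k → Dpath G)
    (C : Fin c → Set V) (z : ℕ) (B : Set V) : Prop :=
  (∀ i, sv i ∈ B) ∧ (∀ i, tv i ∉ B) ∧
  (∀ a, CAcceptable sv tv L (C a) (B ∩ C a)) ∧
  ∀ a b, a ≠ b → ∀ i, wiggle (L i) (B ∩ C b) (Bᶜ ∩ C a) ≤ z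

/-- The vertices of `l` belonging to `C`, in order. -/
def inOrderIn (l : List V) (C : Set V) : List V := l.filter fun v => decide (v ∈ C)

/-- The last `m` (or "up to `m`") vertices of the path `P` in `C`, in order along `P`. -/
def lastIn {G : Dgraph V} (P : Dpath G) (C : Set V) (m : ℕ) : List V :=
  (inOrderIn P.verts C).drop ((inOrderIn P.verts C).length - m)

/-- The first up-to-`m` vertices of the path `P` in `C`, in order along `P`. -/
def firstUpTo {G : Dgraph V} (P : Dpath G) (C : Set V) (m : ℕ) : List V :=
  (inOrderIn P.verts C).take m

/-- The set of terms of a vertex sequence. -/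
def seqSet (X : List V) : Set V := {v | v ∈ X}

/-- `𝒜⁺` for a set `𝒜` of vertex sequences. -/
def plusSet (G : Dgraph V) {c : ℕ} (C : Fin c → Set V) (s : ℕ) (𝒜 : Set (List V)) : Set V :=
  {v | ∃ X ∈ 𝒜, ∃ a, insert v (seqSet X) ⊆ C a ∧
    (v ∈ X ∨ (v ∉ X ∧ X.length = s ∧ ∀ u ∈ X.drop (X.length - (s - 1)), G.adj u v))}

/-- `𝒜⁻` for a set `𝒜` of vertex sequences. -/
def minusSet (G : Dgraph V) {c : ℕ} (C : Fin c → Set V) (s : ℕ) (𝒜 : Set (List V)) : Set V :=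
  {v | ∃ X ∈ 𝒜, ∃ a, insert v (seqSet X) ⊆ C a ∧
    (v ∈ X ∨ (v ∉ X ∧ X.length = s ∧ ∀ u ∈ X.take (s - 1), G.adj v u))}

/-- A set `D ⊆ V(G)` is `(r,s,t)`-restricted. -/
def Restricted (G : Dgraph V) {c : ℕ} (C : Fin c → Set V) (r s t : ℕ) (D : Set V) : Prop :=
  ∃ 𝒜 ℬ : Set (List V),
    (∀ X ∈ 𝒜, X.length ≤ s) ∧ (∀ X ∈ ℬ, X.length ≤ s) ∧
    𝒜.ncard ≤ r ∧ ℬ.ncard ≤ r ∧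
    (plusSet G C s ℬ ∩ minusSet G C s 𝒜).ncard ≤ t ∧
    plusSet G C s ℬ \ minusSet G C s 𝒜 ⊆ D ∧
    D ⊆ plusSet G C s ℬ

/-- `e` is an enumeration of `V(L) ∖ {s 1,…,s k,t 1,…,t k}`. -/
def IsEnumeration {G : Dgraph V} {k : ℕ} (L : Fin k → Dpath G) (sv tv : Fin k → V)
    (e : List V) : Prop :=
  e.Nodup ∧ {v | v ∈ e} = linkSupport L \ (Set.range sv ∪ Set.range tv)

/-- `B h = {s 1,…,s k} ∪ {v 1,…,v h}`, for the enumeration `e`. -/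
def BsetOf {k : ℕ} (sv : Fin k → V) (e : List V) (h : ℕ) : Set V :=
  Set.range sv ∪ {v | v ∈ e.take h}

/-- `A h = V(L) ∖ B h`. -/
def AsetOf {G : Dgraph V} {k : ℕ} (L : Fin k → Dpath G) (sv : Fin k → V) (e : List V)
    (h : ℕ) : Set V :=
  linkSupport L \ BsetOf sv e h

/-- The maximal subpaths of members of `L` with all vertices in `S`: the components,
included in `S`, of the digraph obtained from `P 1 ∪ ⋯ ∪ P k` by deleting the edges with
exactly one end in `S`. -/
def segsIn {G : Dgraph V} {k : ℕ} (L : Fin k → Dpath G) (S : Set V) : Set (Dpath G) :=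
  {Q | ∃ i, Q.IsSubpath (L i) ∧ Q.support ⊆ S ∧
    ∀ Q' : Dpath G, Q'.IsSubpath (L i) → Q'.support ⊆ S → Q.IsSubpath Q' →
      Q'.verts = Q.verts}

/-- `𝒜 h`: first up-to-`s` vertices in each `C a` of each path of `ℛ h`. -/
def AseqsOf (G : Dgraph V) {k c : ℕ} (C : Fin c → Set V) (s : ℕ) (L : Fin k → Dpath G)
    (sv : Fin k → V) (e : List V) (h : ℕ) : Set (List V) :=
  {X | ∃ R ∈ segsIn L (AsetOf L sv e h), ∃ a, X = firstUpTo R (C a) s}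

/-- `ℬ h`: last up-to-`s` vertices in each `C a` of each path of `𝒬 h`. -/
def BseqsOf (G : Dgraph V) {k c : ℕ} (C : Fin c → Set V) (s : ℕ) (L : Fin k → Dpath G)
    (sv : Fin k → V) (e : List V) (h : ℕ) : Set (List V) :=
  {X | ∃ Q ∈ segsIn L (BsetOf sv e h), ∃ a, X = lastIn Q (C a) s}

/-- `D h = (ℬ h⁺ ∖ 𝒜 h⁻) ∪ B h`. -/
def DsetOf (G : Dgraph V) {k c : ℕ} (C : Fin c → Set V) (s : ℕ) (L : Fin k → Dpath G)
    (sv : Fin k → V) (e : List V) (h : ℕ) : Set V :=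
  (plusSet G C s (BseqsOf G C s L sv e h) \ minusSet G C s (AseqsOf G C s L sv e h))
    ∪ BsetOf sv e h

/-- The edges of the members of a linkage. -/
def linkEdges {G : Dgraph V} {k : ℕ} (L : Fin k → Dpath G) : Set (V × V) :=
  ⋃ i, {p | p ∈ (L i).edges}

/-- `J h`: the edges of `P 1 ∪ ⋯ ∪ P k` with one end in `A h` and the other in `B h`. -/
def JsetOf {G : Dgraph V} {k : ℕ} (L : Fin k → Dpath G) (sv : Fin k → V) (e : List V)
    (h : ℕ) : Set (V × V) :=
  {p ∈ linkEdges L |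
    (p.1 ∈ AsetOf L sv e h ∧ p.2 ∈ BsetOf sv e h) ∨
    (p.1 ∈ BsetOf sv e h ∧ p.2 ∈ AsetOf L sv e h)}

/-- `Y h = {(e,i) : e ∈ J h ∩ E(P i)}`, as a set of coloured edges. -/
def YsetOf {G : Dgraph V} {k : ℕ} (L : Fin k → Dpath G) (sv : Fin k → V) (e : List V)
    (h : ℕ) : Set ((V × V) × Fin k) :=
  {p | p.1 ∈ JsetOf L sv e h ∧ p.1 ∈ (L p.2).edges}

/-- `ℰ`: the admissible sets of coloured edges (a coloured edge is a pair `(e,i)` with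
`e ∈ E(G)` and `i` a colour in `Fin k`; its tail is `e.1` and its head is `e.2`). -/
def EdgeSets (G : Dgraph V) {k : ℕ} (sv tv : Fin k → V) (w : ℕ) :
    Set (Set ((V × V) × Fin k)) :=
  {Y | (∀ p ∈ Y, G.adj p.1.1 p.1.2) ∧
    Y.ncard ≤ 2 * w - 1 ∧
    (∀ p ∈ Y, ∀ q ∈ Y, p ≠ q → p.1.2 ≠ q.1.2 ∧ p.1.1 ≠ q.1.1) ∧
    (∀ p ∈ Y, ∀ q ∈ Y, ({p.1.1, p.1.2} ∩ {q.1.1, q.1.2} : Set V).Nonempty → p.2 = q.2) ∧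
    (∀ p ∈ Y, p.1.2 ∉ Set.range sv ∧ p.1.1 ∉ Set.range tv) ∧
    (∀ p ∈ Y, ∀ i, (p.1.1 = sv i → p.2 = i) ∧ (p.1.2 = tv i → p.2 = i))}

/-- The vertices of the auxiliary digraph `H`: pairs `(Y,D)` with `Y ∈ ℰ`, `D ∈ 𝒟`
(i.e. `D` is `(r,s,t)`-restricted), such that every coloured edge of `Y` has exactly one
end in `D`. -/
def HVert (G : Dgraph V) {k c : ℕ} (sv tv : Fin k → V) (C : Fin c → Set V)
    (w r s t : ℕ) (x : Set ((V × V) × Fin k) × Set V) : Prop :=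
  x.1 ∈ EdgeSets G sv tv w ∧ Restricted G C r s t x.2 ∧
  ∀ p ∈ x.1, Xor' (p.1.1 ∈ x.2) (p.1.2 ∈ x.2)

/-- Adjacency in the auxiliary digraph `H`. -/
def HAdj (G : Dgraph V) {k c : ℕ} (sv tv : Fin k → V) (C : Fin c → Set V)
    (w r s t : ℕ) (x y : Set ((V × V) × Fin k) × Set V) : Prop :=
  x ≠ y ∧ HVert G sv tv C w r s t x ∧ HVert G sv tv C w r s t y ∧ x.2 ⊆ y.2 ∧
  ∃ p q : (V × V) × Fin k, p ≠ q ∧ symmDiff x.1 y.1 = {p, q} ∧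
    p.1.2 = q.1.1 ∧ p.1.1 ≠ q.1.2 ∧ p.1.2 ∈ y.2 \ x.2

/-- The auxiliary digraph `H`. -/
def auxH (G : Dgraph V) {k c : ℕ} (sv tv : Fin k → V) (C : Fin c → Set V)
    (w r s t : ℕ) : Dgraph (Set ((V × V) × Fin k) × Set V) :=
  ⟨HAdj G sv tv C w r s t, fun _ hx => hx.1 rfl⟩

/-- `S 0`: the vertices `(Y,D)` of `H` with `|Y| = k` and every member of `Y` having tail
in `{s 1,…,s k}`. -/
def S0set (G : Dgraph V) {k c : ℕ} (sv tv : Fin k → V) (C : Fin c → Set V)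
    (w r s t : ℕ) : Set (Set ((V × V) × Fin k) × Set V) :=
  {x | HVert G sv tv C w r s t x ∧ x.1.ncard = k ∧ ∀ p ∈ x.1, p.1.1 ∈ Set.range sv}

/-- `T 0`: the vertices `(Y,D)` of `H` with `|Y| = k` and every member of `Y` having head
in `{t 1,…,t k}`. -/
def T0set (G : Dgraph V) {k c : ℕ} (sv tv : Fin k → V) (C : Fin c → Set V)
    (w r s t : ℕ) : Set (Set ((V × V) × Fin k) × Set V) :=
  {x | HVert G sv tv C w r s t x ∧ x.1.ncard = k ∧ ∀ p ∈ x.1, p.1.2 ∈ Set.range tv}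

end

theorem vo_chain_init {α : Type} {R : α → α → Prop} {l m : List α} (h : l.IsChain R)
    (hm : m <+: l) : m.IsChain R := by
  obtain ⟨t, rfl⟩ := hm
  exact (List.isChain_append.1 h).1


/-- Reachability inside a set of vertices. -/
def Rch {V : Type} (G : Dgraph V) (S : Set V) (u v : V) : Prop :=
  u ∈ S ∧ Relation.ReflTransGen (fun a b => G.adj a b ∧ b ∈ S) u v

theorem Rch.refl {V : Type} {G : Dgraph V} {S : Set V} {u : V} (h : u ∈ S) : Rch G S u u :=
  ⟨h, Relation.ReflTransGen.refl⟩

theorem Rch.mem_right {V : Type} {G : Dgraph V} {S : Set V} {u v : V} (h : Rch G S u v) :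
    v ∈ S := by
  obtain ⟨h1, h2⟩ := h
  rcases Relation.ReflTransGen.cases_tail h2 with h | ⟨w, _, h3⟩
  · exact h ▸ h1
  · exact h3.2

theorem Rch.trans {V : Type} {G : Dgraph V} {S : Set V} {u v w : V} (h : Rch G S u v)
    (h' : Rch G S v w) : Rch G S u w :=
  ⟨h.1, h.2.trans h'.2⟩

theorem Rch.edge {V : Type} {G : Dgraph V} {S : Set V} {u v w : V} (h : Rch G S u v)
    (h' : G.adj v w) (hw : w ∈ S) : Rch G S u w :=
  ⟨h.1, h.2.tail ⟨h', hw⟩⟩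

theorem Rch.mono {V : Type} {G : Dgraph V} {S T : Set V} {u v : V} (h : Rch G S u v)
    (hST : S ⊆ T) : Rch G T u v :=
  by
  refine ⟨hST h.1, ?_⟩
  have h2 := h.2
  clear h
  induction h2 with
  | refl => exact Relation.ReflTransGen.refl
  | tail _ h3 ih => exact ih.tail ⟨h3.1, hST h3.2⟩

/-- The vertices of `on` between `u` and `v` on the path of `u`. -/
def Seg {V : Type} {k : ℕ} (on : Set V) (pth : V → Fin k) (pos : V → ℕ) (u v : V) : Set V :=
  {w | w ∈ on ∧ pth w = pth u ∧ pos u ≤ pos w ∧ pos w ≤ pos v}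

/-- Coordinates for a minimum linkage. -/
structure LD {V : Type} (G : Dgraph V) (k : ℕ) (on : Set V) (pth : V → Fin k) (pos : V → ℕ)
    (sv tv : Fin k → V) : Prop where
  inj : ∀ u ∈ on, ∀ v ∈ on, pth u = pth v → pos u = pos v → u = v
  pred : ∀ v ∈ on, pos v ≠ 0 → ∃ u ∈ on, pth u = pth v ∧ pos u + 1 = pos v ∧ G.adj u v
  s_on : ∀ i, sv i ∈ on
  s_pth : ∀ i, pth (sv i) = i
  s_pos : ∀ i, pos (sv i) = 0
  t_on : ∀ i, tv i ∈ on
  t_pth : ∀ i, pth (tv i) = i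
  t_max : ∀ v ∈ on, pos v ≤ pos (tv (pth v))
  min : ∀ S : Fin k → Set V, (∀ i j, i ≠ j → Disjoint (S i) (S j)) →
    (∀ i, Rch G (S i) (sv i) (tv i)) → on.ncard ≤ (⋃ i, S i).ncard

namespace LD

variable {V : Type} [Fintype V] {G : Dgraph V} {k : ℕ} {on : Set V} {pth : V → Fin k}
  {pos : V → ℕ} {sv tv : Fin k → V}

theorem walk (H : LD G k on pth pos sv tv) : ∀ (n : ℕ) (u v : V), u ∈ on → v ∈ on →
    pth u = pth v → pos u + n = pos v → Rch G (Seg on pth pos u v) u v := by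
  intro n
  induction n with
  | zero =>
    intro u v hu hv h1 h2
    have : u = v := H.inj u hu v hv h1 (by omega)
    subst this
    exact Rch.refl ⟨hu, rfl, le_rfl, le_rfl⟩
  | succ n ih =>
    intro u v hu hv h1 h2
    obtain ⟨w, hw, h3, h4, h5⟩ := H.pred v hv (by omega)
    have := ih u w hu hw (h1.trans h3.symm) (by omega)
    refine (this.mono ?_).edge h5 ⟨hv, h1.symm, by omega, le_rfl⟩
    rintro x ⟨a, b, c, d⟩
    exact ⟨a, b, c, by omega⟩

theorem walk' (H : LD G k on pth pos sv tv) {u v : V} (hu : u ∈ on) (hv : v ∈ on)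
    (h : pth u = pth v) (h' : pos u ≤ pos v) : Rch G (Seg on pth pos u v) u v :=
  H.walk (pos v - pos u) u v hu hv h (by omega)

theorem subst (H : LD G k on pth pos sv tv) {J : Type} (e f : J → V) (he : ∀ j, e j ∈ on)
    (hf : ∀ j, f j ∈ on) (hef : ∀ j, pth (e j) = pth (f j)) (hle : ∀ j, pos (e j) ≤ pos (f j))
    (hdis : ∀ j j', j ≠ j' → Disjoint (Seg on pth pos (e j) (f j)) (Seg on pth pos (e j') (f j')))
    (T : J → Set V) (hT : ∀ j j', j ≠ j' → Disjoint (T j) (T j'))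
    (hTon : ∀ j, T j ∩ on ⊆ ⋃ j', Seg on pth pos (e j') (f j'))
    (hr : ∀ j, Rch G (T j) (e j) (f j)) :
    (⋃ j, Seg on pth pos (e j) (f j)).ncard ≤ (⋃ j, T j).ncard := by
  set tr := ⋃ j, Seg on pth pos (e j) (f j) with htr
  have memtr : ∀ v, v ∈ tr ↔ ∃ j, v ∈ Seg on pth pos (e j) (f j) := by simp [htr]
  let S : Fin k → Set V := fun i => {v | v ∈ on ∧ pth v = i ∧ v ∉ tr} ∪
    ⋃ j, {v | v ∈ T j ∧ pth (e j) = i}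
  have hsegon : ∀ j v, v ∈ Seg on pth pos (e j) (f j) → v ∈ on := fun j v h => h.1
  have key : ∀ n v, pos v = n → v ∈ on → (v ∉ tr ∨ ∃ j, v = f j) →
      Rch G (S (pth v)) (sv (pth v)) v := by
    intro n
    induction n using Nat.strong_induction_on with
    | _ n ih =>
    have step : ∀ v, v ∈ on → pos v ≤ n → v ∈ S (pth v) → (v ∉ tr ∨ ∃ j, v = e j) →
        Rch G (S (pth v)) (sv (pth v)) v := by
      intro v hv hvn hvS hor
      by_cases h0 : pos v = 0
      · have : sv (pth v) = v := H.inj _ (H.s_on _) v hv (H.s_pth _) (by rw [H.s_pos, h0])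
        rw [this]
        exact Rch.refl hvS
      · obtain ⟨u, hu, h3, h4, h5⟩ := H.pred v hv h0
        have := ih (pos u) (by omega) u rfl hu ?_
        · rw [h3] at this
          exact this.edge h5 hvS
        · by_cases hut : u ∈ tr
          · right
            obtain ⟨j, hj⟩ := (memtr u).1 hut
            refine ⟨j, ?_⟩
            by_contra hne
            have hlt : pos u < pos (f j) := by
              rcases Nat.lt_or_ge (pos u) (pos (f j)) with h | h
              · exact h
              · exact absurd (H.inj u hu _ (hf j) (hj.2.1.trans (hef j))
                  (le_antisymm hj.2.2.2 h)) hne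
            have hvj : v ∈ Seg on pth pos (e j) (f j) :=
              ⟨hv, h3.symm.trans hj.2.1, by have := hj.2.2.1; omega, by omega⟩
            rcases hor with h | ⟨j', rfl⟩
            · exact h ((memtr _).2 ⟨j, hvj⟩)
            · by_cases hjj : j = j'
              · subst hjj
                have := hj.2.2.1
                omega
              · exact Set.disjoint_left.1 (hdis j j' hjj) hvj ⟨he j', rfl, le_rfl, hle j'⟩
          · exact Or.inl hut
    intro v hvn hv hor
    by_cases hvt : v ∈ tr
    · obtain ⟨j, rfl⟩ := hor.resolve_left (by simpa using hvt)
      have hTS : T j ⊆ S (pth (f j)) := by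
        intro x hx
        right
        simp only [Set.mem_iUnion]
        exact ⟨j, hx, hef j⟩
      have h1 : Rch G (S (pth (e j))) (sv (pth (e j))) (e j) := by
        apply step _ (he j) (by have := hle j; omega) _ (Or.inr ⟨j, rfl⟩)
        rw [hef j]
        exact hTS (hr j).1
      rw [hef j] at h1
      exact h1.trans ((hr j).mono hTS)
    · exact step v hv hvn.le (Or.inl ⟨hv, rfl, hvt⟩) (Or.inl hvt)
  have hmin := H.min S ?_ ?_
  · have hsub : (⋃ i, S i) ⊆ (on \ tr) ∪ ⋃ j, T j := by
      intro v hv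
      obtain ⟨i, hi⟩ := Set.mem_iUnion.1 hv
      rcases hi with h | h
      · exact Or.inl ⟨h.1, h.2.2⟩
      · right
        obtain ⟨j, hj⟩ := Set.mem_iUnion.1 h
        exact Set.mem_iUnion.2 ⟨j, hj.1⟩
    have h1 := Set.ncard_le_ncard hsub (Set.toFinite _)
    have h2 := Set.ncard_union_le (on \ tr) (⋃ j, T j)
    have hton : tr ⊆ on := by
      intro v hv
      obtain ⟨j, hj⟩ := (memtr v).1 hv
      exact hj.1
    have h3 := Set.ncard_sdiff_add_ncard_of_subset hton (Set.toFinite _)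
    omega
  · intro i i' hii
    rw [Set.disjoint_left]
    intro v hv hv'
    rcases hv with h | h <;> rcases hv' with h' | h'
    · exact hii (h.2.1.symm.trans h'.2.1)
    · obtain ⟨j, hj⟩ := Set.mem_iUnion.1 h'
      exact h.2.2 (hTon j ⟨hj.1, h.1⟩)
    · obtain ⟨j, hj⟩ := Set.mem_iUnion.1 h
      exact h'.2.2 (hTon j ⟨hj.1, h'.1⟩)
    · obtain ⟨j, hj⟩ := Set.mem_iUnion.1 h
      obtain ⟨j', hj'⟩ := Set.mem_iUnion.1 h'
      by_cases hjj : j = j'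
      · subst hjj
        exact hii (hj.2.symm.trans hj'.2)
      · exact Set.disjoint_left.1 (hT j j' hjj) hj.1 hj'.1
  · intro i
    have := key _ (tv i) rfl (H.t_on i) ?_
    · rwa [H.t_pth] at this
    · by_cases h : tv i ∈ tr
      · right
        obtain ⟨j, hj⟩ := (memtr _).1 h
        refine ⟨j, H.inj _ hj.1 _ (hf j) (hj.2.1.trans (hef j)) (le_antisymm hj.2.2.2 ?_)⟩
        have := H.t_max (f j) (hf j)
        rwa [← hef j, ← hj.2.1, H.t_pth] at this
      · exact Or.inl h

theorem no_shortcut (H : LD G k on pth pos sv tv) {u w v : V} (hu : u ∈ on) (hw : w ∈ on)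
    (hv : v ∈ on) (h1 : pth w = pth u) (h2 : pth v = pth u) (h3 : pos u < pos w)
    (h4 : pos w < pos v) : ¬ G.adj u v := by
  intro hadj
  have := H.subst (J := Unit) (fun _ => u) (fun _ => v) (fun _ => hu) (fun _ => hv)
    (fun _ => h2.symm) (fun _ => by omega) (fun j j' h => absurd rfl h)
    (fun _ => {u, v}) (fun j j' h => absurd rfl h) ?_ ?_
  · rw [Set.iUnion_const, Set.iUnion_const] at this
    have hsub : ({u, w, v} : Set V) ⊆ Seg on pth pos u v := by
      intro x hx
      rcases hx with rfl | rfl | rfl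
      · exact ⟨hu, rfl, le_rfl, by omega⟩
      · exact ⟨hw, h1, by omega, by omega⟩
      · exact ⟨hv, h2, by omega, le_rfl⟩
    have h5 := Set.ncard_le_ncard hsub (Set.toFinite _)
    have huw : u ≠ w := by rintro rfl; omega
    have hwv : w ≠ v := by rintro rfl; omega
    have huv : u ≠ v := by rintro rfl; omega
    have h6 : ({u, w, v} : Set V).ncard = 3 := Set.ncard_eq_three.2 ⟨u, w, v, huw, huv, hwv, rfl⟩
    have h7 := Set.ncard_pair huv
    omega
  · rintro - x ⟨hx, -⟩
    rw [Set.iUnion_const]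
    rcases hx with rfl | rfl
    · exact ⟨hu, rfl, le_rfl, by omega⟩
    · exact ⟨hv, h2, by omega, le_rfl⟩
  · intro _
    exact (Rch.refl (by simp)).edge hadj (by simp)

/-- The rotation lemma: rerouting along a cyclic system of tracks. -/
theorem rotate (H : LD G k on pth pos sv tv) {J : Type} (φ : J → J) (hφ : Function.Injective φ)
    (e f : J → V) (he : ∀ j, e j ∈ on)
    (hf : ∀ j, f j ∈ on) (hef : ∀ j, pth (e j) = pth (f j)) (hle : ∀ j, pos (e j) ≤ pos (f j))
    (hdis : ∀ j j', j ≠ j' → Disjoint (Seg on pth pos (e j) (f j)) (Seg on pth pos (e j') (f j')))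
    (R : ℕ) (sg : J → ℕ → Set V) (a b : J → ℕ → V)
    (hsg : ∀ j j' r r', r ≤ R → r' ≤ R → (j ≠ j' ∨ r ≠ r') → Disjoint (sg j r) (sg j' r'))
    (hsgon : ∀ j r, r ≤ R → sg j r ∩ on ⊆ ⋃ j', Seg on pth pos (e j') (f j'))
    (hr : ∀ j r, r ≤ R → Rch G (sg j r) (a j r) (b j r))
    (hedge : ∀ j r, r < R → G.adj (b j r) (a (φ j) (r + 1)))
    (h0 : ∀ j, a j 0 = e j) (hR : ∀ j, b (φ^[R] j) R = f j) :
    (⋃ j, Seg on pth pos (e j) (f j)).ncard ≤ (⋃ j, ⋃ r, ⋃ (_ : r ≤ R), sg j r).ncard := by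
  let T : J → Set V := fun j => ⋃ r, ⋃ (_ : r ≤ R), sg (φ^[r] j) r
  have memT : ∀ j v, v ∈ T j ↔ ∃ r, r ≤ R ∧ v ∈ sg (φ^[r] j) r := by simp [T]
  have hsubT : ∀ j r, r ≤ R → sg (φ^[r] j) r ⊆ T j := fun j r hr v hv => (memT _ _).2 ⟨r, hr, hv⟩
  have h := H.subst e f he hf hef hle hdis T ?_ ?_ ?_
  · refine h.trans (Set.ncard_le_ncard ?_ (Set.toFinite _))
    intro v hv
    obtain ⟨j, hj⟩ := Set.mem_iUnion.1 hv
    obtain ⟨r, hr1, hr2⟩ := (memT _ _).1 hj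
    simp only [Set.mem_iUnion]
    exact ⟨_, r, hr1, hr2⟩
  · intro j j' hjj
    rw [Set.disjoint_left]
    intro v hv hv'
    obtain ⟨r, hr1, hr2⟩ := (memT _ _).1 hv
    obtain ⟨r', hr1', hr2'⟩ := (memT _ _).1 hv'
    refine Set.disjoint_left.1 (hsg _ _ r r' hr1 hr1' ?_) hr2 hr2'
    by_cases hrr : r = r'
    · subst hrr
      exact Or.inl fun h => hjj ((hφ.iterate r) h)
    · exact Or.inr hrr
  · rintro j v ⟨hv, hvo⟩
    obtain ⟨r, hr1, hr2⟩ := (memT _ _).1 hv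
    exact hsgon _ r hr1 ⟨hr2, hvo⟩
  · intro j
    have : ∀ r, r ≤ R → Rch G (T j) (e j) (b (φ^[r] j) r) := by
      intro r
      induction r with
      | zero =>
        intro _
        rw [← h0]
        exact (hr j 0 (Nat.zero_le _)).mono (hsubT j 0 (Nat.zero_le _))
      | succ r ih =>
        intro hrR
        have h1 := (hr (φ^[r+1] j) (r+1) hrR).mono (hsubT j (r+1) hrR)
        refine ((ih (by omega)).edge ?_ h1.1).trans h1
        have := hedge (φ^[r] j) r (by omega)
        rwa [← Function.iterate_succ_apply' φ r j] at this
    rw [← hR]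
    exact this R le_rfl

end LD


theorem vo_cycle {α : Type} [Fintype α] [Nonempty α] (f : α → α) :
    ∃ n : ℕ, 1 ≤ n ∧ n ≤ Fintype.card α ∧ ∃ (φ : Fin n → Fin n) (ι : Fin n → α),
      (∀ j, φ^[n] j = j) ∧ Function.Injective ι ∧ ∀ j, ι (φ j) = f (ι j) := by
  obtain ⟨x0⟩ := ‹Nonempty α›
  obtain ⟨m, m', hmm, heq⟩ := Finite.exists_ne_map_eq_of_infinite (fun m : ℕ => f^[m] x0)
  wlog hlt : m < m' generalizing m m'
  · exact this m' m (Ne.symm hmm) heq.symm (by omega)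
  set x := f^[m] x0 with hx
  have hper : Function.IsPeriodicPt f (m' - m) x := by
    change f^[m' - m] x = x
    rw [hx, ← Function.iterate_add_apply, Nat.sub_add_cancel hlt.le, ← heq]
  have hpos : 0 < Function.minimalPeriod f x := hper.minimalPeriod_pos (by omega)
  have hinj := Function.iterate_injOn_Iio_minimalPeriod (f := f) (x := x)
  have hmod : ∀ m : ℕ, f^[m % Function.minimalPeriod f x] x = f^[m] x := fun m =>
    Function.iterate_mod_minimalPeriod_eq
  have hend : f^[Function.minimalPeriod f x] x = x := Function.iterate_minimalPeriod
  generalize Function.minimalPeriod f x = n at *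
  have hι : Function.Injective (fun j : Fin n => f^[(j : ℕ)] x) := by
    intro a b hab
    exact Fin.ext (hinj a.2 b.2 hab)
  refine ⟨n, hpos, by simpa using Fintype.card_le_of_injective _ hι,
    fun j => ⟨((j : ℕ) + 1) % n, Nat.mod_lt _ hpos⟩, fun j => f^[(j : ℕ)] x, ?_, hι, ?_⟩
  · intro j
    apply hι
    have : ∀ m, f^[((((fun j : Fin n => (⟨((j : ℕ) + 1) % n, Nat.mod_lt _ hpos⟩ : Fin n))^[m] j) : Fin n) : ℕ)] x
        = f^[m] (f^[(j : ℕ)] x) := by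
      intro m
      induction m with
      | zero => rfl
      | succ m ih =>
        rw [Function.iterate_succ_apply', Function.iterate_succ_apply', ← ih]
        simp only
        rw [hmod, Function.iterate_succ_apply']
    simp only at this ⊢
    rw [this, ← Function.iterate_add_apply, Nat.add_comm, Function.iterate_add_apply, hend]
  · intro j
    simp only
    rw [hmod, Function.iterate_succ_apply']

theorem vo_sched {J : Type} : ∀ (N : ℕ) (F : Finset J) (lo hi : J → ℕ → ℕ), F.card = N →
    (∀ j ∈ F, ∀ b < N, lo j b ≤ hi j b) →
    (∀ j ∈ F, ∀ b b', b < b' → b' < N → hi j b < lo j b') →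
    ∃ β : J → ℕ, (∀ j ∈ F, β j < N) ∧ ∀ j ∈ F, ∀ j' ∈ F, j ≠ j' →
      hi j (β j) < lo j' (β j') ∨ hi j' (β j') < lo j (β j) := by
  intro N
  induction N with
  | zero =>
    intro F lo hi hF _ _
    rw [Finset.card_eq_zero] at hF
    subst hF
    exact ⟨fun _ => 0, by simp, by simp⟩
  | succ N ih =>
    intro F lo hi hF h1 h2
    have hne : F.Nonempty := by
      rw [← Finset.card_pos]; omega
    obtain ⟨j0, hj0, hmin⟩ := Finset.exists_min_image F (fun j => hi j 0) hne
    obtain ⟨β, hβ1, hβ2⟩ := ih (F.erase j0) (fun j b => lo j (b + 1)) (fun j b => hi j (b + 1))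
      (by rw [Finset.card_erase_of_mem hj0]; omega)
      (fun j hj b hb => h1 j (Finset.mem_of_mem_erase hj) _ (by omega))
      (fun j hj b b' hb hb' => h2 j (Finset.mem_of_mem_erase hj) _ _ (by omega) (by omega))
    have hk : ∀ j ∈ F, j ≠ j0 → hi j0 0 < lo j (β j + 1) := by
      intro j hj hne
      have := hβ1 j (Finset.mem_erase.2 ⟨hne, hj⟩)
      exact (hmin j hj).trans_lt (h2 j hj _ _ (by omega) (by omega))
    refine ⟨fun j => if j = j0 then 0 else β j + 1, ?_, ?_⟩
    · intro j hj
      by_cases h : j = j0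
      · simp [h]
      · have := hβ1 j (Finset.mem_erase.2 ⟨h, hj⟩)
        simp [h]; omega
    · intro j hj j' hj' hne
      by_cases h : j = j0
      · have h' : j' ≠ j0 := fun h' => hne (h.trans h'.symm)
        left
        simp only [h, h', if_true, if_false]
        exact hk j' hj' h'
      · by_cases h' : j' = j0
        · right
          simp only [h, h', if_true, if_false]
          exact hk j hj h
        · simp only [h, h', if_false]
          exact hβ2 j (Finset.mem_erase.2 ⟨h, hj⟩) j' (Finset.mem_erase.2 ⟨h', hj'⟩) hne

theorem vo_enum (S : Finset ℕ) (t : ℕ) (h : t ≤ S.card) : ∃ f : ℕ → ℕ, (∀ r < t, f r ∈ S) ∧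
    ∀ r r', r < r' → r' < t → f r < f r' := by
  refine ⟨fun r => if h : r < S.card then S.orderEmbOfFin rfl ⟨r, h⟩ else 0, ?_, ?_⟩
  · intro r hr
    simp only [show r < S.card by omega, dif_pos]
    exact Finset.orderEmbOfFin_mem _ _ _
  · intro r r' hr hr'
    simp only [show r < S.card by omega, show r' < S.card by omega, dif_pos]
    simpa using hr

theorem vo_greedy {V : Type} [Fintype V] {t N : ℕ} (hN : t ^ 2 ≤ N) (D : Fin t → ℕ → Set V)
    (hsub : ∀ j m, m < N → (D j m).Subsingleton)
    (hdis : ∀ j m m', m < N → m' < N → m ≠ m' → Disjoint (D j m) (D j m')) :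
    ∃ S : Fin t → Finset ℕ, ∀ j, (S j ⊆ Finset.range N ∧ (S j).card = t) ∧
      ∀ j', j ≠ j' → ∀ m ∈ S j, ∀ m' ∈ S j', Disjoint (D j m) (D j' m') := by
  have key : ∀ F : Finset (Fin t), ∃ S : Fin t → Finset ℕ,
      ∀ j ∈ F, (S j ⊆ Finset.range N ∧ (S j).card = t) ∧
      ∀ j' ∈ F, j ≠ j' → ∀ m ∈ S j, ∀ m' ∈ S j', Disjoint (D j m) (D j' m') := by
    intro F
    induction F using Finset.induction_on with
    | empty => exact ⟨fun _ => ∅, by simp⟩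
    | insert j0 F hj0 ih =>
      obtain ⟨S, hS⟩ := ih
      let U : Finset V := F.biUnion fun j => (S j).biUnion fun m => (D j m).toFinite.toFinset
      have hU : U.card ≤ F.card * t := by
        apply Finset.card_biUnion_le_card_mul
        intro j hj
        have := Finset.card_biUnion_le_card_mul (S j) (fun m => (D j m).toFinite.toFinset) 1 (by
          intro m hm
          rw [Finset.card_le_one]
          intro a ha b hb
          rw [Set.Finite.mem_toFinset] at ha hb
          exact hsub j m (Finset.mem_range.1 ((hS j hj).1.1 hm)) ha hb)
        rw [(hS j hj).1.2] at this
        omega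
      have hFt : F.card + 1 ≤ t := by
        have := Finset.card_le_univ (insert j0 F)
        rw [Finset.card_insert_of_notMem hj0] at this
        simpa using this
      let bad := (Finset.range N).filter fun m => ∃ v ∈ U, v ∈ D j0 m
      have hbad : bad.card ≤ U.card := by
        apply Finset.card_le_card_of_forall_subsingleton (fun m v => v ∈ D j0 m)
        · intro m hm
          exact (Finset.mem_filter.1 hm).2
        · rintro v hv m ⟨hm, hvm⟩ m' ⟨hm', hvm'⟩
          by_contra hne
          exact Set.disjoint_left.1 (hdis j0 m m'
            (Finset.mem_range.1 (Finset.mem_filter.1 hm).1)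
            (Finset.mem_range.1 (Finset.mem_filter.1 hm').1) hne) hvm hvm'
      have hgood : t ≤ (Finset.range N \ bad).card := by
        have hsd := Finset.card_sdiff_of_subset (show bad ⊆ Finset.range N from
          Finset.filter_subset _ _)
        rw [Finset.card_range] at hsd
        rw [hsd]
        have : F.card * t + t ≤ t ^ 2 := by nlinarith
        omega
      obtain ⟨S0, hS0, hS0c⟩ := Finset.exists_subset_card_eq hgood
      have hcross : ∀ j ∈ F, ∀ m ∈ S0, ∀ m' ∈ S j, Disjoint (D j0 m) (D j m') := by
        intro j hj m hm m' hm'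
        rw [Set.disjoint_left]
        intro v hv hv'
        have := hS0 hm
        rw [Finset.mem_sdiff] at this
        apply this.2
        refine Finset.mem_filter.2 ⟨this.1, v, ?_, hv⟩
        simp only [U, Finset.mem_biUnion, Set.Finite.mem_toFinset]
        exact ⟨j, hj, m', hm', hv'⟩
      refine ⟨fun j => if j = j0 then S0 else S j, ?_⟩
      intro j hj
      by_cases h : j = j0
      · subst h
        simp only [if_true]
        refine ⟨⟨fun m hm => (Finset.mem_sdiff.1 (hS0 hm)).1, hS0c⟩, ?_⟩
        intro j' hj' hne
        rw [if_neg (Ne.symm hne)]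
        exact hcross j' (Finset.mem_of_mem_insert_of_ne hj' (Ne.symm hne))
      · have hjF := Finset.mem_of_mem_insert_of_ne hj h
        simp only [h, if_false]
        refine ⟨(hS j hjF).1, ?_⟩
        intro j' hj' hne
        by_cases h' : j' = j0
        · subst h'
          simp only [if_true]
          intro m hm m' hm'
          exact (hcross j hjF m' hm' m hm).symm
        · rw [if_neg h']
          exact (hS j hjF).2 j' (Finset.mem_of_mem_insert_of_ne hj' h') hne
  obtain ⟨S, hS⟩ := key Finset.univ
  exact ⟨S, fun j => ⟨(hS j (Finset.mem_univ _)).1,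
    fun j' hne => (hS j (Finset.mem_univ _)).2 j' (Finset.mem_univ _) hne⟩⟩


namespace LD

theorem path_rot {V : Type} [Fintype V] {G : Dgraph V} {k : ℕ} {on : Set V} {pth : V → Fin k}
    {pos : V → ℕ} {sv tv : Fin k → V} (H : LD G k on pth pos sv tv) {n : ℕ} (hn : 1 ≤ n)
    (φ : Fin n → Fin n) (hφ : ∀ j, φ^[n] j = j) (w : ℕ) (q : Fin n → Fin k)
    (x y : Fin n → ℕ → V)
    (hx : ∀ j p, p < w → x j p ∈ on ∧ pth (x j p) = q j)
    (hy : ∀ j p, p < w → y j p ∈ on ∧ pth (y j p) = q j)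
    (hxy : ∀ j p, p < w → pos (x j p) < pos (y j p))
    (hyx : ∀ j p p', p < p' → p' < w → pos (y j p) < pos (x j p'))
    (hdis : ∀ j j', j ≠ j' → q j = q j' →
      pos (y j (w - 1)) < pos (x j' 0) ∨ pos (y j' (w - 1)) < pos (x j 0))
    (p : ℕ → ℕ) (hp : ∀ r < n, p r + 2 < w) (hp2 : ∀ r, r + 1 < n → p r + 2 ≤ p (r + 1))
    (hadj : ∀ j, ∀ r < n, G.adj (y j (p r)) (x (φ j) (p r + 2))) : False := by
  have hinj : Function.Injective φ := by
    intro a b hab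
    rw [← hφ a, ← hφ b]
    obtain ⟨m, rfl⟩ : ∃ m, n = m + 1 := ⟨n - 1, by omega⟩
    rw [Function.iterate_succ_apply, Function.iterate_succ_apply, hab]
  let Q : ℕ → ℕ := fun r => if r = 0 then 0 else p (r - 1) + 2
  have hQ0 : Q 0 = 0 := rfl
  have hQs : ∀ r, Q (r + 1) = p r + 2 := fun r => by simp [Q]
  have hQw : ∀ r ≤ n, Q r < w := by
    intro r hr
    rcases r with _ | r
    · have := hp 0 (by omega)
      rw [hQ0]; omega
    · rw [hQs]; exact hp r (by omega)
  have hQp : ∀ r < n, Q r ≤ p r := by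
    intro r hr
    rcases r with _ | r
    · rw [hQ0]; omega
    · rw [hQs]; exact hp2 r hr
  have hpQ : ∀ r r', r < r' → r' ≤ n → p r + 2 ≤ Q r' := by
    intro r r' h
    induction r' with
    | zero => omega
    | succ r' ih =>
      intro hr'
      rw [hQs]
      rcases Nat.lt_or_ge r r' with h1 | h1
      · have := ih h1 (by omega)
        have := hQp r' (by omega)
        omega
      · have : r = r' := by omega
        subst this
        omega
  have hxx : ∀ j a b, a ≤ b → b < w → pos (x j a) ≤ pos (x j b) := by
    intro j a b h hb
    rcases Nat.lt_or_ge a b with h1 | h1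
    · exact ((hxy j a (by omega)).trans (hyx j a b h1 hb)).le
    · have : a = b := by omega
      rw [this]
  have hxx' : ∀ j a b, a < b → b < w → pos (x j a) < pos (x j b) := by
    intro j a b h hb
    exact ((hxy j a (by omega)).trans (hyx j a b h hb))
  have hxylast : ∀ j a, a < w → pos (x j a) ≤ pos (y j (w - 1)) := fun j a ha =>
    (hxx j a (w - 1) (by omega) (by omega)).trans (hxy j _ (by omega)).le
  let e : Fin n → V := fun j => x j 0
  let f : Fin n → V := fun j => x j (Q n)
  let b : Fin n → ℕ → V := fun j r => if r < n then y j (p r) else x j (Q n)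
  have hbe : ∀ j r, r < n → b j r = y j (p r) := fun j r h => by simp [b, h]
  have hbn : ∀ j, b j n = x j (Q n) := fun j => by simp [b]
  have hbon : ∀ j r, r ≤ n → b j r ∈ on ∧ pth (b j r) = q j := by
    intro j r hr
    by_cases h : r < n
    · rw [hbe j r h]; exact hy j _ (by have := hp r h; omega)
    · have : r = n := by omega
      subst this
      rw [hbn]; exact hx j _ (hQw _ le_rfl)
  have hab : ∀ j r, r ≤ n → pos (x j (Q r)) ≤ pos (b j r) := by
    intro j r hr
    by_cases h : r < n
    · rw [hbe j r h]
      have h1 := hp r h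
      exact (hxx j _ (p r) (hQp r h) (by omega)).trans (hxy j _ (by omega)).le
    · have : r = n := by omega
      subst this
      rw [hbn]
  have hbx : ∀ j r r', r < r' → r' ≤ n → pos (b j r) < pos (x j (Q r')) := by
    intro j r r' h h'
    rw [hbe j r (by omega)]
    exact hyx j _ _ (by have := hpQ r r' h h'; omega) (hQw r' h')
  have hbf : ∀ j r, r ≤ n → pos (b j r) ≤ pos (f j) := by
    intro j r hr
    by_cases h : r < n
    · exact (hbx j r n h le_rfl).le
    · have : r = n := by omega
      subst this
      rw [hbn]
  let sg : Fin n → ℕ → Set V := fun j r => Seg on pth pos (x j (Q r)) (b j r)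
  have hsgtr : ∀ j r, r ≤ n → sg j r ⊆ Seg on pth pos (e j) (f j) := by
    rintro j r hr v ⟨h1, h2, h3, h4⟩
    refine ⟨h1, ?_, ?_, h4.trans (hbf j r hr)⟩
    · rw [h2, (hx j _ (hQw r hr)).2, (hx j 0 (by have := hQw 0 (by omega); omega)).2]
    · exact (hxx j 0 _ (Nat.zero_le _) (hQw r hr)).trans h3
  have hw0 : 0 < w := by have := hQw 0 (by omega); omega
  have htrdis : ∀ j j', j ≠ j' →
      Disjoint (Seg on pth pos (e j) (f j)) (Seg on pth pos (e j') (f j')) := by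
    intro j j' hne
    rw [Set.disjoint_left]
    rintro v ⟨_, h2, h3, h4⟩ ⟨_, h2', h3', h4'⟩
    have hq : q j = q j' := by
      rw [← (hx j 0 hw0).2, ← (hx j' 0 hw0).2]
      exact h2.symm.trans h2'
    have := hxylast j (Q n) (hQw n le_rfl)
    have := hxylast j' (Q n) (hQw n le_rfl)
    rcases hdis j j' hne hq with h | h
    · simp only [e, f] at *; omega
    · simp only [e, f] at *; omega
  have := H.rotate φ hinj e f (fun j => (hx j 0 hw0).1) (fun j => (hx j _ (hQw n le_rfl)).1)
    (fun j => by simp only [e, f]; rw [(hx j 0 hw0).2, (hx j _ (hQw n le_rfl)).2])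
    (fun j => hxx j 0 _ (Nat.zero_le _) (hQw n le_rfl)) htrdis n sg (fun j r => x j (Q r)) b
    ?_ ?_ ?_ ?_ (fun j => by simp only [hQ0, e]) (fun j => by rw [hφ, hbn])
  · have hlt : (⋃ j, ⋃ r, ⋃ (_ : r ≤ n), sg j r) ⊂ ⋃ j, Seg on pth pos (e j) (f j) := by
      constructor
      · intro v hv
        simp only [Set.mem_iUnion] at hv ⊢
        obtain ⟨j, r, hr, hv⟩ := hv
        exact ⟨j, hsgtr j r hr hv⟩
      · intro hsub
        let j0 : Fin n := ⟨0, hn⟩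
        have h0w := hp 0 (by omega)
        have hmem : x j0 (p 0 + 1) ∈ Seg on pth pos (e j0) (f j0) := by
          refine ⟨(hx j0 _ (by omega)).1, ?_, hxx j0 _ _ (by omega) (by omega), ?_⟩
          · rw [(hx j0 _ (by omega)).2]; exact (hx j0 0 hw0).2.symm
          · have := hpQ 0 n (by omega) le_rfl
            exact hxx j0 _ _ (by omega) (hQw n le_rfl)
        have h1 := hsub (Set.mem_iUnion.2 ⟨j0, hmem⟩)
        simp only [Set.mem_iUnion] at h1
        obtain ⟨j, r, hr, hv⟩ := h1
        by_cases hj : j = j0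
        · subst hj
          obtain ⟨_, _, h3, h4⟩ := hv
          rcases Nat.eq_zero_or_pos r with h | h
          · subst h
            rw [hbe _ _ (by omega)] at h4
            have := hyx j0 (p 0) (p 0 + 1) (by omega) (by omega)
            omega
          · have h5 := hpQ 0 r h hr
            have := hxx' j0 (p 0 + 1) (Q r) (by omega) (hQw r hr)
            omega
        · exact Set.disjoint_left.1 (htrdis j j0 hj) (hsgtr j r hr hv) hmem
    have := Set.ncard_lt_ncard hlt (Set.toFinite _)
    omega
  · intro j j' r r' hr hr' hor
    by_cases hj : j = j'
    · subst hj
      have hrr : r ≠ r' := hor.resolve_left (by simp)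
      rw [Set.disjoint_left]
      rintro v ⟨_, _, h3, h4⟩ ⟨_, _, h3', h4'⟩
      rcases Nat.lt_or_ge r r' with h | h
      · have := hbx j r r' h hr'
        omega
      · have := hbx j r' r (by omega) hr
        omega
    · exact (htrdis j j' hj).mono (hsgtr j r hr) (hsgtr j' r' hr')
  · rintro j r hr v ⟨hv, -⟩
    exact Set.mem_iUnion.2 ⟨j, hsgtr j r hr hv⟩
  · intro j r hr
    exact H.walk' (hx j _ (hQw r hr)).1 (hbon j r hr).1
      (by rw [(hx j _ (hQw r hr)).2, (hbon j r hr).2]) (hab j r hr)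
  · intro j r hr
    simp only [hbe j r hr, hQs]
    exact hadj j r hr

theorem clique_rot {V : Type} [Fintype V] {G : Dgraph V} {k : ℕ} {on : Set V} {pth : V → Fin k}
    {pos : V → ℕ} {sv tv : Fin k → V} (H : LD G k on pth pos sv tv) {t : ℕ} (ht : 1 ≤ t)
    (htk : t ≤ k) (φ : Fin t → Fin t) (hφ : ∀ j, φ^[t] j = j) (q : Fin t → Fin k)
    (hq : Function.Injective q) (x y : Fin t → ℕ → V) (Ms : Fin t → ℕ → Set V)
    (B C : Set V) (hC : G.IsClique C)
    (hx : ∀ j m, m < k ^ 2 + k + 1 → x j m ∈ on ∧ pth (x j m) = q j ∧ x j m ∈ B ∧ x j m ∈ C)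
    (hy : ∀ j m, m < k ^ 2 + k + 1 →
      y j m ∈ on ∧ pth (y j m) = q (φ j) ∧ y j m ∉ B ∧ y j m ∈ C)
    (hxs : ∀ j m m', m < m' → m' < k ^ 2 + k + 1 → pos (x j m) < pos (x j m'))
    (hys : ∀ j m m', m < m' → m' < k ^ 2 + k + 1 → pos (y j m) < pos (y j m'))
    (hM : ∀ j m, m < k ^ 2 + k + 1 → Rch G (Ms j m) (x j m) (y j m) ∧ (Ms j m).ncard ≤ 3 ∧
      Ms j m ∩ on ⊆ {x j m, y j m} ∧ (Ms j m \ on).Subsingleton)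
    (hMd : ∀ j m m', m < k ^ 2 + k + 1 → m' < k ^ 2 + k + 1 → m ≠ m' →
      Disjoint (Ms j m) (Ms j m'))
    (hmono : ∀ u v, u ∈ on → v ∈ on → pth u = pth v → u ∈ C → v ∈ C → u ∈ B → v ∉ B →
      pos u < pos v) : False := by
  have hinj : Function.Injective φ := by
    intro a b hab
    rw [← hφ a, ← hφ b]
    obtain ⟨m, rfl⟩ : ∃ m, t = m + 1 := ⟨t - 1, by omega⟩
    rw [Function.iterate_succ_apply, Function.iterate_succ_apply, hab]
  have htt : t ^ 2 ≤ k ^ 2 + k := by nlinarith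
  have h2k : 2 * k < k ^ 2 + k + 1 := by nlinarith [sq_nonneg ((k : ℤ) - 1)]
  generalize hN : k ^ 2 + k = N at *
  obtain ⟨S, hS⟩ := vo_greedy htt (fun j m => Ms j m \ on)
    (fun j m hm => (hM j m (by omega)).2.2.2)
    (fun j m m' hm hm' hne => (hMd j m m' (by omega) (by omega) hne).mono
      Set.diff_subset Set.diff_subset)
  have hen : ∀ j, ∃ f : ℕ → ℕ, (∀ r < t, f r ∈ S j) ∧ ∀ r r', r < r' → r' < t → f r < f r' :=
    fun j => vo_enum (S j) t (hS j).1.2.ge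
  choose μ hμS hμ using hen
  have hμN : ∀ j r, r < t → μ j r < N := fun j r hr =>
    Finset.mem_range.1 ((hS j).1.1 (hμS j r hr))
  have hμle : ∀ j r r', r ≤ r' → r' < t → μ j r ≤ μ j r' := by
    intro j r r' h h'
    rcases Nat.lt_or_ge r r' with h1 | h1
    · exact (hμ j r r' h1 h').le
    · rw [show r = r' by omega]
  have hμt : ∀ j r, r < t → μ j 0 + r ≤ μ j r := by
    intro j r
    induction r with
    | zero => intro _; omega
    | succ r ih =>
      intro h
      have := ih (by omega)
      have := hμ j r (r + 1) (by omega) h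
      omega
  have hxle : ∀ j m m', m ≤ m' → m' < N + 1 → pos (x j m) ≤ pos (x j m') := by
    intro j r r' h h'
    rcases Nat.lt_or_ge r r' with h1 | h1
    · exact (hxs j r r' h1 h').le
    · rw [show r = r' by omega]
  have hyle : ∀ j m m', m ≤ m' → m' < N + 1 → pos (y j m) ≤ pos (y j m') := by
    intro j r r' h h'
    rcases Nat.lt_or_ge r r' with h1 | h1
    · exact (hys j r r' h1 h').le
    · rw [show r = r' by omega]
  have hφ1 : ∀ j, φ (φ^[t - 1] j) = j := by
    intro j
    rw [← Function.iterate_succ_apply' φ, Nat.succ_eq_add_one, Nat.sub_add_cancel ht, hφ]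
  have hxy : ∀ j m m', m < N + 1 → m' < N + 1 → pos (x (φ j) m) < pos (y j m') := by
    intro j m m' hm hm'
    have h1 := hx (φ j) m hm
    have h2 := hy j m' hm'
    exact hmono _ _ h1.1 h2.1 (h1.2.1.trans h2.2.1.symm) h1.2.2.2 h2.2.2.2 h1.2.2.1 h2.2.2.1
  let e : Fin t → V := fun j => x j (μ j 0)
  let f : Fin t → V := fun j => y (φ^[t - 1] j) (μ (φ^[t - 1] j) (t - 1))
  have he : ∀ j, e j ∈ on ∧ pth (e j) = q j := fun j => by
    have := hx j _ (show μ j 0 < N + 1 by have := hμN j 0 (by omega); omega)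
    exact ⟨this.1, this.2.1⟩
  have hf : ∀ j, f j ∈ on ∧ pth (f j) = q j := fun j => by
    have := hy (φ^[t - 1] j) _ (show μ (φ^[t - 1] j) (t - 1) < N + 1 by
      have := hμN (φ^[t - 1] j) (t - 1) (by omega); omega)
    rw [hφ1] at this
    exact ⟨this.1, this.2.1⟩
  have hxtr : ∀ j m, m < N + 1 → μ j 0 ≤ m → x j m ∈ Seg on pth pos (e j) (f j) := by
    intro j m hm hm'
    refine ⟨(hx j m hm).1, (hx j m hm).2.1.trans (he j).2.symm, hxle j _ _ hm' hm, ?_⟩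
    have := hxy (φ^[t - 1] j) m _ hm (show μ (φ^[t - 1] j) (t - 1) < N + 1 by
      have := hμN (φ^[t - 1] j) (t - 1) (by omega); omega)
    rw [hφ1] at this
    exact this.le
  have hback : ∀ j, φ^[t - 1] (φ j) = j := by
    intro j
    apply hinj
    rw [hφ1]
  have hytr : ∀ j m, m < N + 1 → m ≤ μ j (t - 1) →
      y j m ∈ Seg on pth pos (e (φ j)) (f (φ j)) := by
    intro j m hm hm'
    refine ⟨(hy j m hm).1, (hy j m hm).2.1.trans (he (φ j)).2.symm, ?_, ?_⟩
    · exact (hxy j _ m (by have := hμN (φ j) 0 (by omega); omega) hm).le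
    · simp only [f]
      rw [hback]
      exact hyle j _ _ hm' (by have := hμN j (t - 1) (by omega); omega)
  have hmain := H.rotate φ hinj e f (fun j => (he j).1) (fun j => (hf j).1)
    (fun j => (he j).2.trans (hf j).2.symm)
    (fun j => (hxtr j (μ j 0) (by have := hμN j 0 (by omega); omega) le_rfl).2.2.2)
    ?_ (t - 1) (fun j r => Ms j (μ j r)) (fun j r => x j (μ j r)) (fun j r => y j (μ j r))
    ?_ ?_ ?_ ?_ (fun j => rfl) (fun j => rfl)
  · -- counting
    have hup : (⋃ j, ⋃ r, ⋃ (_ : r ≤ t - 1), Ms j (μ j r)).ncard ≤ t * t * 3 := by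
      have hsub : (⋃ j, ⋃ r, ⋃ (_ : r ≤ t - 1), Ms j (μ j r)) ⊆
          ⋃ z : Fin t × Fin t, Ms z.1 (μ z.1 z.2) := by
        intro v hv
        simp only [Set.mem_iUnion] at hv ⊢
        obtain ⟨j, r, hr, hv⟩ := hv
        exact ⟨(j, ⟨r, by omega⟩), hv⟩
      refine (Set.ncard_le_ncard hsub (Set.toFinite _)).trans ?_
      refine (Set.ncard_iUnion_le_of_fintype _).trans ?_
      refine (Finset.sum_le_card_nsmul _ _ 3 ?_).trans ?_
      · rintro ⟨j, r⟩ -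
        exact (hM j _ (by have := hμN j r r.2; simp only; omega)).2.1
      · simp
    let F : Fin t × Fin (N + 1 + t) → V := fun z =>
      if (z.2 : ℕ) ≤ μ z.1 (t - 1) then y z.1 z.2 else x z.1 (z.2 - (μ z.1 (t - 1) + 1) + μ z.1 0)
    have hFlt : ∀ z : Fin t × Fin (N + 1 + t), ¬ (z.2 : ℕ) ≤ μ z.1 (t - 1) →
        z.2 - (μ z.1 (t - 1) + 1) + μ z.1 0 < N + 1 := by
      intro z hz
      have := hμt z.1 (t - 1) (by omega)
      have := z.2.2
      omega
    have hylt : ∀ (z : Fin t × Fin (N + 1 + t)), (z.2 : ℕ) ≤ μ z.1 (t - 1) → (z.2 : ℕ) < N + 1 := by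
      intro z hz
      have := hμN z.1 (t - 1) (by omega)
      omega
    have hxinj : ∀ j m m', m < N + 1 → m' < N + 1 → x j m = x j m' → m = m' := by
      intro j m m' hm hm' h
      rcases lt_trichotomy m m' with h1 | h1 | h1
      · have := hxs j m m' h1 hm'; rw [h] at this; omega
      · exact h1
      · have := hxs j m' m h1 hm; rw [h] at this; omega
    have hyinj : ∀ j m m', m < N + 1 → m' < N + 1 → y j m = y j m' → m = m' := by
      intro j m m' hm hm' h
      rcases lt_trichotomy m m' with h1 | h1 | h1
      · have := hys j m m' h1 hm'; rw [h] at this; omega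
      · exact h1
      · have := hys j m' m h1 hm; rw [h] at this; omega
    have hFinj : Function.Injective F := by
      rintro ⟨j, m⟩ ⟨j', m'⟩ h
      by_cases h1 : (m : ℕ) ≤ μ j (t - 1) <;> by_cases h2 : (m' : ℕ) ≤ μ j' (t - 1)
      · simp only [F, h1, h2, if_true] at h
        have a1 := hylt (j, m) h1
        have a2 := hylt (j', m') h2
        simp only at a1 a2
        have hj : j = j' := by
          apply hinj
          apply hq
          rw [← (hy j m a1).2.1, ← (hy j' m' a2).2.1, h]
        subst hj
        have := hyinj j m m' a1 a2 h
        rw [Fin.ext this]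
      · simp only [F, h1, h2, if_true, if_false] at h
        have a1 := hylt (j, m) h1
        have a2 := hFlt (j', m') h2
        exact absurd (h ▸ (hx j' _ a2).2.2.1) (hy j m a1).2.2.1
      · simp only [F, h1, h2, if_true, if_false] at h
        have a1 := hFlt (j, m) h1
        have a2 := hylt (j', m') h2
        exact absurd (h ▸ (hx j _ a1).2.2.1) (hy j' m' a2).2.2.1
      · simp only [F, h1, h2, if_false] at h
        have a1 := hFlt (j, m) h1
        have a2 := hFlt (j', m') h2
        simp only at a1 a2
        have hj : j = j' := by
          apply hq
          rw [← (hx j _ a1).2.1, ← (hx j' _ a2).2.1, h]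
        subst hj
        have := hxinj j _ _ a1 a2 h
        rw [show m = m' from Fin.ext (by omega)]
    have hlow : t * (N + 1 + t) ≤ (⋃ j, Seg on pth pos (e j) (f j)).ncard := by
      have h1 : (Set.range F).ncard = t * (N + 1 + t) := by
        rw [← Set.image_univ, Set.ncard_image_of_injective _ hFinj, Set.ncard_univ]
        simp
      rw [← h1]
      apply Set.ncard_le_ncard _ (Set.toFinite _)
      rintro _ ⟨z, rfl⟩
      by_cases h1 : (z.2 : ℕ) ≤ μ z.1 (t - 1)
      · simp only [F, h1, if_true]
        exact Set.mem_iUnion.2 ⟨_, hytr z.1 _ (hylt z h1) h1⟩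
      · simp only [F, h1, if_false]
        exact Set.mem_iUnion.2 ⟨_, hxtr z.1 _ (hFlt z h1) (by omega)⟩
    have : t * t * 3 < t * (N + 1 + t) := by
      rw [Nat.mul_assoc]
      apply Nat.mul_lt_mul_of_pos_left _ (by omega)
      omega
    omega
  · intro j j' hne
    rw [Set.disjoint_left]
    rintro v ⟨_, h2, _, _⟩ ⟨_, h2', _, _⟩
    apply hne
    apply hq
    rw [← (he j).2, ← (he j').2, ← h2, ← h2']
  · intro j j' r r' hr hr' hor
    have hmN := hμN j r (by omega)
    have hmN' := hμN j' r' (by omega)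
    by_cases hj : j = j'
    · subst hj
      have hrr : r ≠ r' := hor.resolve_left (by simp)
      refine hMd j _ _ (by omega) (by omega) ?_
      rcases Nat.lt_or_ge r r' with h | h
      · exact (hμ j r r' h (by omega)).ne
      · exact (hμ j r' r (by omega) (by omega)).ne'
    · rw [Set.disjoint_left]
      intro v hv hv'
      by_cases hvo : v ∈ on
      · have h1 := (hM j _ (by omega)).2.2.1 ⟨hv, hvo⟩
        have h2 := (hM j' _ (by omega)).2.2.1 ⟨hv', hvo⟩
        have x1 := hx j _ (show μ j r < N + 1 by omega)
        have y1 := hy j _ (show μ j r < N + 1 by omega)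
        have x2 := hx j' _ (show μ j' r' < N + 1 by omega)
        have y2 := hy j' _ (show μ j' r' < N + 1 by omega)
        rcases h1 with h1 | h1 <;> rcases h2 with h2 | h2
        · exact hj (hq (by rw [← x1.2.1, ← x2.2.1, ← h1, ← h2]))
        · exact y2.2.2.1 (h2 ▸ h1 ▸ x1.2.2.1)
        · exact y1.2.2.1 (h1 ▸ h2 ▸ x2.2.2.1)
        · exact hj (hinj (hq (by rw [← y1.2.1, ← y2.2.1, ← h1, ← h2])))
      · exact Set.disjoint_left.1 ((hS j).2 j' hj _ (hμS j r (by omega)) _ (hμS j' r' (by omega)))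
          ⟨hv, hvo⟩ ⟨hv', hvo⟩
  · rintro j r hr v hv
    have hmN := hμN j r (by omega)
    rcases (hM j _ (by omega)).2.2.1 hv with h | h
    · exact Set.mem_iUnion.2 ⟨j, h ▸ hxtr j _ (by omega) (hμle j 0 r (by omega) (by omega))⟩
    · exact Set.mem_iUnion.2 ⟨φ j, h ▸ hytr j _ (by omega) (hμle j r _ (by omega) (by omega))⟩
  · intro j r hr
    have hmN := hμN j r (by omega)
    exact (hM j _ (by omega)).1
  · intro j r hr
    have hmN := hμN j r (by omega)
    have hmN' := hμN (φ j) (r + 1) (by omega)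
    have x1 := hx (φ j) _ (show μ (φ j) (r + 1) < N + 1 by omega)
    have w1 := hx (φ j) N (by omega)
    have y1 := hy j _ (show μ j r < N + 1 by omega)
    rcases hC _ x1.2.2.2 _ y1.2.2.2 (fun h => y1.2.2.1 (h ▸ x1.2.2.1)) with h | h
    · exact absurd h (H.no_shortcut x1.1 w1.1 y1.1 (w1.2.1.trans x1.2.1.symm)
        (y1.2.1.trans x1.2.1.symm) (hxs _ _ _ hmN' (by omega)) (hxy j N _ (by omega) (by omega)))
    · exact h

end LD


theorem vo_path {V : Type} {G : Dgraph V} {S : Set V} {u v : V} (h : Rch G S u v) :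
    ∃ P : Dpath G, P.first = u ∧ P.last = v ∧ P.support ⊆ S := by
  obtain ⟨hu, h⟩ := h
  induction h with
  | refl =>
    exact ⟨⟨[u], by simp, by simp, List.isChain_singleton _⟩, rfl, rfl, by
      intro x hx; simp [Dpath.support] at hx; exact hx ▸ hu⟩
  | @tail b c _ hbc ih =>
    obtain ⟨P, h1, h2, h3⟩ := ih
    by_cases hc : c ∈ P.verts
    · obtain ⟨l1, l2, hl⟩ := List.append_of_mem hc
      have hpre : (l1 ++ [c]) <+: P.verts := ⟨l2, by rw [hl]; simp⟩
      refine ⟨⟨l1 ++ [c], by simp, P.nodup.sublist hpre.sublist, vo_chain_init P.chain hpre⟩, ?_, ?_, ?_⟩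
      · rw [← h1]
        simp only [Dpath.first]
        have : P.verts.head? = (l1 ++ [c]).head? := by
          rw [hl]; cases l1 <;> simp
        have h5 := List.head?_eq_some_head P.ne
        have h6 := List.head?_eq_some_head (show l1 ++ [c] ≠ [] by simp)
        rw [h5, h6] at this
        exact (Option.some.inj this).symm
      · simp [Dpath.last]
      · intro x hx
        exact h3 (hpre.subset hx)
    · refine ⟨⟨P.verts ++ [c], by simp, ?_, ?_⟩, ?_, ?_, ?_⟩
      · exact List.Nodup.append P.nodup (by simp) (by simpa using hc)
      · apply List.IsChain.append P.chain (List.isChain_singleton _)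
        intro x hx y hy
        simp only [List.head?_cons, Option.mem_def, Option.some.injEq] at hy
        subst hy
        rw [List.getLast?_eq_some_getLast P.ne] at hx
        simp only [Option.mem_def, Option.some.injEq] at hx
        subst hx
        have : P.verts.getLast P.ne = b := h2
        rw [this]
        exact hbc.1
      · rw [← h1]
        simp only [Dpath.first]
        exact List.head_append_of_ne_nil _
      · simp [Dpath.last]
      · intro x hx
        simp only [Dpath.support, Set.mem_ofPred_eq, List.mem_append, List.mem_singleton] at hx
        rcases hx with hx | hx
        · exact h3 hx
        · exact hx ▸ hbc.2

/-- Bundled coordinates for a minimum linkage. -/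
structure LC {V : Type} {G : Dgraph V} {k : ℕ} (L : Fin k → Dpath G) (sv tv : Fin k → V)
    (pth : V → Fin k) (pos : V → ℕ) : Prop where
  ld : LD G k (linkSupport L) pth pos sv tv
  mem : ∀ v i, v ∈ (L i).verts ↔ v ∈ linkSupport L ∧ pth v = i
  idx : ∀ v i, v ∈ (L i).verts → pos v = (L i).verts.idxOf v

theorem LC.sub {V : Type} {G : Dgraph V} {k : ℕ} {L : Fin k → Dpath G} {sv tv : Fin k → V}
    {pth : V → Fin k} {pos : V → ℕ} (H : LC L sv tv pth pos) (i : Fin k) (l : List V) :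
    l.Sublist (L i).verts ↔ (∀ v ∈ l, v ∈ linkSupport L ∧ pth v = i) ∧
      l.Pairwise (fun u v => pos u < pos v) := by
  have hpw : (L i).verts.Pairwise (fun u v => pos u < pos v) := by
    rw [List.pairwise_iff_getElem]
    intro a b ha hb hab
    rw [H.idx _ i (List.getElem_mem ha), H.idx _ i (List.getElem_mem hb),
      (L i).nodup.idxOf_getElem, (L i).nodup.idxOf_getElem]
    exact hab
  constructor
  · intro h
    exact ⟨fun v hv => (H.mem v i).1 (h.subset hv), hpw.sublist h⟩
  · rintro ⟨h1, h2⟩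
    have hnd : l.Nodup := h2.imp (by rintro a b h rfl; exact lt_irrefl _ h)
    have hsub : l.Subperm (L i).verts := hnd.subperm fun v hv => (H.mem v i).2 (h1 v hv)
    haveI : Std.Antisymm (fun u v : V => pos u < pos v) :=
      ⟨fun a b h h' => absurd (lt_trans h h') (lt_irrefl _)⟩
    exact List.sublist_of_subperm_of_pairwise hsub h2 hpw

theorem vo_LC {V : Type} [Fintype V] {k : ℕ} (hk : 1 ≤ k)
    (G : Dgraph V) (sv tv : Fin k → V) (L : Fin k → Dpath G) (hL : IsMinimumLinkageFor L sv tv) :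
    ∃ pth pos, LC L sv tv pth pos := by
  obtain ⟨⟨hl, hends⟩, hmin⟩ := hL
  let pth : V → Fin k := fun v => if h : ∃ i, v ∈ (L i).verts then h.choose else ⟨0, hk⟩
  have hon : ∀ v, v ∈ linkSupport L ↔ ∃ i, v ∈ (L i).verts := by
    intro v
    simp [linkSupport, Dpath.support]
  have hmem : ∀ v i, v ∈ (L i).verts ↔ v ∈ linkSupport L ∧ pth v = i := by
    intro v i
    constructor
    · intro h
      have hex : ∃ i, v ∈ (L i).verts := ⟨i, h⟩
      refine ⟨(hon v).2 hex, ?_⟩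
      simp only [pth, hex, dif_pos]
      by_contra hne
      exact Set.disjoint_left.1 (hl _ _ hne) hex.choose_spec h
    · rintro ⟨h, rfl⟩
      have hex := (hon v).1 h
      simp only [pth, hex, dif_pos]
      exact hex.choose_spec
  have hself : ∀ v, v ∈ linkSupport L → v ∈ (L (pth v)).verts := fun v h => (hmem v _).2 ⟨h, rfl⟩
  let pos : V → ℕ := fun v => (L (pth v)).verts.idxOf v
  have hidx : ∀ v i, v ∈ (L i).verts → pos v = (L i).verts.idxOf v := by
    intro v i h
    have := ((hmem v i).1 h).2
    simp only [pos, this]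
  have hsv : ∀ i, sv i ∈ (L i).verts := fun i => by
    rw [← (hends i).1]; exact List.head_mem _
  have htv : ∀ i, tv i ∈ (L i).verts := fun i => by
    rw [← (hends i).2]; exact List.getLast_mem _
  refine ⟨pth, pos, ⟨⟨?_, ?_, ?_, ?_, ?_, ?_, ?_, ?_, ?_⟩, hmem, hidx⟩⟩
  · intro u hu v hv h1 h2
    simp only [pos] at h2
    rw [← h1] at h2
    exact (List.idxOf_inj (hself u hu)).1 h2
  · intro v hv h0
    have hv' := hself v hv
    have hlt : pos v < (L (pth v)).verts.length := List.idxOf_lt_length_of_mem hv'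
    have hu : (L (pth v)).verts[pos v - 1]'(by omega) ∈ (L (pth v)).verts :=
      List.getElem_mem _
    refine ⟨(L (pth v)).verts[pos v - 1]'(by omega), ?_, ?_, ?_, ?_⟩
    · exact ((hmem _ _).1 hu).1
    · exact ((hmem _ _).1 hu).2
    · rw [hidx _ _ hu, (L (pth v)).nodup.idxOf_getElem]
      omega
    · have hc := (L (pth v)).chain
      have := List.isChain_iff_getElem.1 hc (pos v - 1) (by omega)
      have h2 : (L (pth v)).verts[pos v - 1 + 1]'(by omega) = v := by
        have : pos v - 1 + 1 = (L (pth v)).verts.idxOf v := by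
          change pos v - 1 + 1 = pos v
          omega
        simp only [this]
        exact List.getElem_idxOf _
      rw [h2] at this
      exact this
  · intro i; exact ((hmem _ _).1 (hsv i)).1
  · intro i; exact ((hmem _ _).1 (hsv i)).2
  · intro i
    rw [hidx _ _ (hsv i), ← (hends i).1]
    simp only [Dpath.first]
    rw [List.head_eq_getElem, (L i).nodup.idxOf_getElem]
  · intro i; exact ((hmem _ _).1 (htv i)).1
  · intro i; exact ((hmem _ _).1 (htv i)).2
  · intro v hv
    have hlt := List.idxOf_lt_length_of_mem (hself v hv)
    rw [hidx _ _ (htv (pth v)), ← (hends (pth v)).2, hidx _ _ (hself v hv)]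
    simp only [Dpath.last]
    rw [List.getLast_eq_getElem, (L (pth v)).nodup.idxOf_getElem]
    omega
  · intro S hS hr
    choose P hP1 hP2 hP3 using fun i => vo_path (hr i)
    have := hmin.2 P (fun i j hne => (hS i j hne).mono (hP3 i) (hP3 j))
      (fun i => ⟨(hP1 i).trans (hends i).1.symm, (hP2 i).trans (hends i).2.symm⟩)
    refine this.trans (Set.ncard_le_ncard ?_ (Set.toFinite _))
    exact Set.iUnion_mono hP3


theorem vo_short {V : Type} [Fintype V] {G : Dgraph V} (P : Dpath G) (on : Set V)
    (hlen : P.verts.length ≤ 3) (hne : P.first ≠ P.last)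
    (hb : ∀ v ∈ P.support, v ≠ P.first → v ≠ P.last → v ∉ on) :
    Rch G P.support P.first P.last ∧ P.support.ncard ≤ 3 ∧
      P.support ∩ on ⊆ {P.first, P.last} ∧ (P.first ∈ on → P.last ∈ on →
        (P.support \ on).Subsingleton) := by
  obtain ⟨l, h1, h2, h3⟩ := P
  match l, h1, h2, h3, hlen, hne, hb with
  | [a], h1, h2, h3, hlen, hne, hb => exact absurd rfl hne
  | [a, b], h1, h2, h3, hlen, hne, hb =>
    have hs : (Dpath.mk (G := G) [a, b] h1 h2 h3).support = {a, b} := by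
      ext v; simp [Dpath.support]
    have hf : (Dpath.mk (G := G) [a, b] h1 h2 h3).first = a := rfl
    have hl : (Dpath.mk (G := G) [a, b] h1 h2 h3).last = b := rfl
    rw [hf, hl, hs]
    have hadj : G.adj a b := by
      have h4 : [a, b].IsChain G.adj := h3
      simpa using h4
    refine ⟨(Rch.refl (by simp)).edge hadj (by simp), ?_, ?_, ?_⟩
    · have := Set.ncard_insert_le a {b}
      rw [Set.ncard_singleton] at this
      omega
    · exact Set.inter_subset_left
    · intro ha hb
      rintro x ⟨hx, hx'⟩
      rcases hx with rfl | rfl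
      · exact absurd ha hx'
      · exact absurd hb hx'
  | [a, b, d], h1, h2, h3, hlen, hne, hb =>
    have hs : (Dpath.mk (G := G) [a, b, d] h1 h2 h3).support = {a, b, d} := by
      ext v; simp [Dpath.support]
    have hf : (Dpath.mk (G := G) [a, b, d] h1 h2 h3).first = a := rfl
    have hl : (Dpath.mk (G := G) [a, b, d] h1 h2 h3).last = d := rfl
    rw [hf, hl] at *
    rw [hs]
    have hadj : G.adj a b ∧ G.adj b d := by
      have h4 : [a, b, d].IsChain G.adj := h3
      simpa using h4
    have hbon : b ∉ on := hb b (by rw [hs]; simp) (by rintro rfl; simp at h2)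
      (by rintro rfl; simp at h2)
    refine ⟨((Rch.refl (by simp)).edge hadj.1 (by simp)).edge hadj.2 (by simp), ?_, ?_, ?_⟩
    · have := Set.ncard_insert_le a {b, d}
      have := Set.ncard_insert_le b {d}
      rw [Set.ncard_singleton] at this
      omega
    · rintro x ⟨hx, hx'⟩
      rcases hx with rfl | rfl | rfl
      · simp
      · exact absurd hx' hbon
      · simp
    · intro ha hd
      have : ∀ x ∈ ({a, b, d} : Set V) \ on, x = b := by
        rintro x ⟨hx, hx'⟩
        rcases hx with rfl | rfl | rfl
        · exact absurd ha hx'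
        · rfl
        · exact absurd hd hx'
      intro x hx y hy
      rw [this x hx, this y hy]

section

variable {V : Type} [Fintype V] {G : Dgraph V} {k : ℕ} {L : Fin k → Dpath G} {sv tv : Fin k → V}
    {pth : V → Fin k} {pos : V → ℕ}

theorem vo_match (H : LC L sv tv pth pos) {n : ℕ} (i j : Fin k) (M : Fin n → Dpath G)
    (X Y : Set V) (hXY : Disjoint X Y) (hM : IsPlanarMatchingFromTo (L i) (L j) M X Y)
    (hI : InternallyDisjointFrom M L) :
    ∃ (x y : ℕ → V) (Ms : ℕ → Set V),
      (∀ m (hm : m < n), x m = (M ⟨m, hm⟩).first ∧ y m = (M ⟨m, hm⟩).last) ∧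
      (∀ m, m < n → x m ∈ linkSupport L ∧ pth (x m) = i ∧ x m ∈ X) ∧
      (∀ m, m < n → y m ∈ linkSupport L ∧ pth (y m) = j ∧ y m ∈ Y) ∧
      (∀ m m', m < m' → m' < n → pos (x m) < pos (x m')) ∧
      (∀ m m', m < m' → m' < n → pos (y m) < pos (y m')) ∧
      (∀ m, m < n → Rch G (Ms m) (x m) (y m) ∧ (Ms m).ncard ≤ 3 ∧
        Ms m ∩ linkSupport L ⊆ {x m, y m} ∧ (Ms m \ linkSupport L).Subsingleton) ∧
      (∀ m m', m < n → m' < n → m ≠ m' → Disjoint (Ms m) (Ms m')) := by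
  obtain ⟨⟨hlink, hlen, hs1, hs2⟩, hXYm⟩ := hM
  obtain ⟨h1, h1'⟩ := (H.sub i _).1 hs1
  obtain ⟨h2, h2'⟩ := (H.sub j _).1 hs2
  have h1 : ∀ m, (M m).first ∈ linkSupport L ∧ pth (M m).first = i := fun m =>
    h1 _ ((List.mem_ofFn' _ _).2 ⟨m, rfl⟩)
  have h2 : ∀ m, (M m).last ∈ linkSupport L ∧ pth (M m).last = j := fun m =>
    h2 _ ((List.mem_ofFn' _ _).2 ⟨m, rfl⟩)
  rw [List.pairwise_ofFn] at h1' h2'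
  have hsh : ∀ m, _ := fun m => vo_short (M m) (linkSupport L) (hlen m)
    (fun h => Set.disjoint_left.1 hXY (hXYm m).1 (h ▸ (hXYm m).2)) (by
      intro v hv hvf hvl
      apply hI
      refine ⟨Set.mem_iUnion.2 ⟨m, hv⟩, ?_⟩
      rintro (⟨m', hm'⟩ | ⟨m', hm'⟩)
      · by_cases hmm : m' = m
        · subst hmm; exact hvf hm'.symm
        · exact Set.disjoint_left.1 (hlink m' m hmm) (by
            rw [← hm']; exact List.head_mem _) hv
      · by_cases hmm : m' = m
        · subst hmm; exact hvl hm'.symm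
        · exact Set.disjoint_left.1 (hlink m' m hmm) (by
            rw [← hm']; exact List.getLast_mem _) hv)
  refine ⟨fun m => if h : m < n then (M ⟨m, h⟩).first else sv i,
    fun m => if h : m < n then (M ⟨m, h⟩).last else sv i,
    fun m => if h : m < n then (M ⟨m, h⟩).support else ∅, ?_, ?_, ?_, ?_, ?_, ?_, ?_⟩
  · intro m hm
    simp only [hm, dif_pos, and_self]
  · intro m hm
    simp only [hm, dif_pos]
    exact ⟨(h1 _).1, (h1 _).2, (hXYm _).1⟩
  · intro m hm
    simp only [hm, dif_pos]
    exact ⟨(h2 _).1, (h2 _).2, (hXYm _).2⟩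
  · intro m m' hmm hm'
    simp only [hm', hmm.trans hm', dif_pos]
    exact h1' hmm
  · intro m m' hmm hm'
    simp only [hm', hmm.trans hm', dif_pos]
    exact h2' hmm
  · intro m hm
    simp only [hm, dif_pos]
    have := hsh ⟨m, hm⟩
    exact ⟨this.1, this.2.1, this.2.2.1, this.2.2.2 (h1 _).1 (h2 _).1⟩
  · intro m m' hm hm' hne
    simp only [hm, hm', dif_pos]
    exact hlink _ _ (by simpa using hne)

theorem vo_mkmatch (H : LC L sv tv pth pos) {n : ℕ} (i j : Fin k) (x y : ℕ → V)
    (X Y : Set V) (hXY : Disjoint X Y)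
    (hx : ∀ m, m < n → x m ∈ linkSupport L ∧ pth (x m) = i ∧ x m ∈ X)
    (hy : ∀ m, m < n → y m ∈ linkSupport L ∧ pth (y m) = j ∧ y m ∈ Y)
    (hxs : ∀ m m', m < m' → m' < n → pos (x m) < pos (x m'))
    (hys : ∀ m m', m < m' → m' < n → pos (y m) < pos (y m'))
    (hadj : ∀ m, m < n → G.adj (x m) (y m)) :
    ∃ M : Fin n → Dpath G, IsPlanarMatchingFromTo (L i) (L j) M X Y ∧
      InternallyDisjointFrom M L := by
  have hxy : ∀ m m', m < n → m' < n → x m ≠ y m' := fun m m' hm hm' h =>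
    Set.disjoint_left.1 hXY (hx m hm).2.2 (h ▸ (hy m' hm').2.2)
  have hxi : ∀ m m', m < n → m' < n → x m = x m' → m = m' := by
    intro m m' hm hm' h
    rcases lt_trichotomy m m' with h1 | h1 | h1
    · have := hxs m m' h1 hm'; rw [h] at this; omega
    · exact h1
    · have := hxs m' m h1 hm; rw [h] at this; omega
  have hyi : ∀ m m', m < n → m' < n → y m = y m' → m = m' := by
    intro m m' hm hm' h
    rcases lt_trichotomy m m' with h1 | h1 | h1
    · have := hys m m' h1 hm'; rw [h] at this; omega
    · exact h1
    · have := hys m' m h1 hm; rw [h] at this; omega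
  let M : Fin n → Dpath G := fun m => ⟨[x m, y m], by simp,
    by simpa using hxy m m m.2 m.2, by
      have : [x m, y m].IsChain G.adj := by simpa using hadj m m.2
      exact this⟩
  have hsup : ∀ m v, v ∈ (M m).support ↔ v = x m ∨ v = y m := by
    intro m v; simp [M, Dpath.support]
  have hf : ∀ m, (M m).first = x m := fun m => rfl
  have hl : ∀ m, (M m).last = y m := fun m => rfl
  refine ⟨M, ⟨⟨?_, ?_, ?_, ?_⟩, ?_⟩, ?_⟩
  · intro m m' hne
    have hne' : (m : ℕ) ≠ m' := fun h => hne (Fin.ext h)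
    rw [Set.disjoint_left]
    intro v hv hv'
    rcases (hsup m v).1 hv with h | h <;> rcases (hsup m' v).1 hv' with h' | h'
    · exact hne' (hxi m m' m.2 m'.2 (h.symm.trans h'))
    · exact hxy m m' m.2 m'.2 (h.symm.trans h')
    · exact hxy m' m m'.2 m.2 (h'.symm.trans h)
    · exact hne' (hyi m m' m.2 m'.2 (h.symm.trans h'))
  · intro m; simp [M]
  · rw [H.sub]
    constructor
    · intro v hv
      obtain ⟨m, rfl⟩ := (List.mem_ofFn' _ _).1 hv
      exact ⟨(hx m m.2).1, (hx m m.2).2.1⟩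
    · rw [List.pairwise_ofFn]
      intro a b hab
      exact hxs a b hab b.2
  · rw [H.sub]
    constructor
    · intro v hv
      obtain ⟨m, rfl⟩ := (List.mem_ofFn' _ _).1 hv
      exact ⟨(hy m m.2).1, (hy m m.2).2.1⟩
    · rw [List.pairwise_ofFn]
      intro a b hab
      exact hys a b hab b.2
  · intro m
    exact ⟨(hx m m.2).2.2, (hy m m.2).2.2⟩
  · rintro v ⟨hv, hv'⟩
    exfalso
    obtain ⟨m, hm⟩ := Set.mem_iUnion.1 hv
    rcases (hsup m v).1 hm with h | h
    · exact hv' (Or.inl ⟨m, h.symm⟩)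
    · exact hv' (Or.inr ⟨m, h.symm⟩)

end


/-- Coordinate version of an alternating sequence with `m` pairs on path `i`. -/
def FAlt {V : Type} {k : ℕ} (on : Set V) (pth : V → Fin k) (pos : V → ℕ) (i : Fin k)
    (X Y : Set V) (m : ℕ) : Prop :=
  ∃ x y : ℕ → V, (∀ p < m, x p ∈ on ∧ pth (x p) = i ∧ x p ∈ X) ∧
    (∀ p < m, y p ∈ on ∧ pth (y p) = i ∧ y p ∈ Y) ∧
    (∀ p < m, pos (x p) < pos (y p)) ∧ ∀ p p', p < p' → p' < m → pos (y p) < pos (x p')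

/-- The invariant maintained along the enumeration. -/
structure VInv {V : Type} {G : Dgraph V} {k c : ℕ} (L : Fin k → Dpath G) (sv tv : Fin k → V)
    (C : Fin c → Set V) (pth : V → Fin k) (pos : V → ℕ) (B : Set V) : Prop where
  s : ∀ i, sv i ∈ B
  sub : B ⊆ linkSupport L
  t : ∀ i, tv i ∉ B
  mono : ∀ u v a, u ∈ linkSupport L → v ∈ linkSupport L → pth u = pth v → u ∈ C a → v ∈ C a →
    pos u < pos v → v ∈ B → u ∈ B
  mat : ∀ a i j, ¬ ∃ M : Fin (k ^ 2 + k + 2) → Dpath G,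
    IsPlanarMatchingFromTo (L i) (L j) M (B ∩ C a) (C a \ (B ∩ C a)) ∧ InternallyDisjointFrom M L
  alt : ∀ a b, a ≠ b → ∀ i,
    ¬ FAlt (linkSupport L) pth pos i (B ∩ C a) (C b \ B) (2 * zOf k c + 1)

section

variable {V : Type} [Fintype V] {G : Dgraph V} {k c : ℕ} {L : Fin k → Dpath G}
    {sv tv : Fin k → V} {pth : V → Fin k} {pos : V → ℕ} {C : Fin c → Set V} {B : Set V}

theorem VInv.lt (H : LC L sv tv pth pos) (I : VInv L sv tv C pth pos B) {u v : V} {a : Fin c}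
    (hu : u ∈ linkSupport L) (hv : v ∈ linkSupport L) (h : pth u = pth v) (hua : u ∈ C a)
    (hva : v ∈ C a) (huB : u ∈ B) (hvB : v ∉ B) : pos u < pos v := by
  by_contra hlt
  rcases Nat.lt_or_ge (pos v) (pos u) with h1 | h1
  · exact hvB (I.mono v u a hv hu h.symm hva hua h1 huB)
  · exact hvB (H.ld.inj u hu v hv h (by omega) ▸ huB)

theorem vo_z_pos (hc : 1 ≤ c) : 1 ≤ zOf k c := by
  unfold zOf
  exact Nat.mul_pos hc (by omega)

theorem VInv.base (hc : 1 ≤ c) (hinst : IsInstance sv tv) (H : LC L sv tv pth pos) :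
    VInv L sv tv C pth pos (Set.range sv) := by
  have hz := vo_z_pos (k := k) hc
  refine ⟨fun i => ⟨i, rfl⟩, ?_, ?_, ?_, ?_, ?_⟩
  · rintro _ ⟨i, rfl⟩
    exact H.ld.s_on i
  · rintro i ⟨j, hj⟩
    exact hinst.2.2 j i hj
  · rintro u v a - - - - - hlt ⟨i, rfl⟩
    rw [H.ld.s_pos] at hlt
    omega
  · rintro a i j ⟨M, hM, hI⟩
    obtain ⟨x, y, Ms, _, hx, hy, hxs, _⟩ := vo_match H i j M _ _
      (by rw [Set.disjoint_left]; intro v hv hv'; exact hv'.2 hv) hM hI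
    have h2 := hxs 0 1 (by omega) (by omega)
    obtain ⟨⟨i', hi'⟩, _⟩ := (hx 1 (by omega)).2.2
    rw [← hi', H.ld.s_pos] at h2
    omega
  · rintro a b - i ⟨x, y, hx, hy, h1, h2⟩
    have h3 := h2 0 1 (by omega) (by omega)
    obtain ⟨⟨i', hi'⟩, _⟩ := (hx 1 (by omega)).2.2
    rw [← hi', H.ld.s_pos] at h3
    omega

theorem vo_clique (hpart : G.IsCliquePartition C) (H : LC L sv tv pth pos)
    (I : VInv L sv tv C pth pos B) (a : Fin c)
    (hinc : ∃ v ∈ linkSupport L, v ∉ B ∧ v ∉ Set.range tv ∧ v ∈ C a) :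
    ∃ r ∈ linkSupport L, r ∉ B ∧ r ∉ Set.range tv ∧ r ∈ C a ∧
      (∀ u ∈ linkSupport L, pth u = pth r → u ∈ C a → pos u < pos r → u ∈ B) ∧
      ∀ a' i j, ¬ ∃ M : Fin (k ^ 2 + k + 2) → Dpath G,
        IsPlanarMatchingFromTo (L i) (L j) M (insert r B ∩ C a') (C a' \ (insert r B ∩ C a')) ∧
        InternallyDisjointFrom M L := by
  by_contra hcon
  push Not at hcon
  have huniq : ∀ v b b', v ∈ C b → v ∈ C b' → b = b' := fun v b b' h h' =>
    (hpart.2 v).unique h h'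
  let α := {i : Fin k // ∃ v ∈ linkSupport L, pth v = i ∧ v ∉ B ∧ v ∉ Set.range tv ∧ v ∈ C a}
  have : Nonempty α := by
    obtain ⟨v, h1, h2, h3, h4⟩ := hinc
    exact ⟨⟨pth v, v, h1, rfl, h2, h3, h4⟩⟩
  have hstep : ∀ i : α, ∃ (j : α) (x y : ℕ → V) (Ms : ℕ → Set V),
      (∀ m, m < k ^ 2 + k + 1 → x m ∈ linkSupport L ∧ pth (x m) = i.1 ∧ x m ∈ B ∧ x m ∈ C a) ∧
      (∀ m, m < k ^ 2 + k + 1 → y m ∈ linkSupport L ∧ pth (y m) = j.1 ∧ y m ∉ B ∧ y m ∈ C a) ∧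
      (∀ m m', m < m' → m' < k ^ 2 + k + 1 → pos (x m) < pos (x m')) ∧
      (∀ m m', m < m' → m' < k ^ 2 + k + 1 → pos (y m) < pos (y m')) ∧
      (∀ m, m < k ^ 2 + k + 1 → Rch G (Ms m) (x m) (y m) ∧ (Ms m).ncard ≤ 3 ∧
        Ms m ∩ linkSupport L ⊆ {x m, y m} ∧ (Ms m \ linkSupport L).Subsingleton) ∧
      (∀ m m', m < k ^ 2 + k + 1 → m' < k ^ 2 + k + 1 → m ≠ m' → Disjoint (Ms m) (Ms m')) := by
    rintro ⟨i, v, hv1, hv2, hv3, hv4, hv5⟩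
    let S : Set V := {u | u ∈ linkSupport L ∧ pth u = i ∧ u ∉ B ∧ u ∈ C a}
    obtain ⟨r, ⟨hr1, hr2, hr3, hr4⟩, hrmin⟩ := Set.exists_min_image S pos (Set.toFinite _)
      ⟨v, hv1, hv2, hv3, hv5⟩
    have hrt : r ∉ Set.range tv := by
      rintro ⟨i', rfl⟩
      rw [H.ld.t_pth] at hr2
      subst hr2
      have h1 := hrmin v ⟨hv1, hv2, hv3, hv5⟩
      have h2 := H.ld.t_max v hv1
      rw [hv2] at h2
      apply hv4
      exact ⟨i', (H.ld.inj v hv1 _ (H.ld.t_on i') (by rw [hv2, H.ld.t_pth]) (by omega)).symm⟩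
    have hrfirst : ∀ u ∈ linkSupport L, pth u = pth r → u ∈ C a → pos u < pos r → u ∈ B := by
      intro u h1 h2 h3 h4
      by_contra h5
      have := hrmin u ⟨h1, h2.trans hr2, h5, h3⟩
      omega
    obtain ⟨a', i0, j0, M, hM, hI⟩ := hcon r hr1 hr3 hrt hr4 hrfirst
    have hex : ∃ m, (M m).first = r := by
      by_contra hno
      push Not at hno
      refine I.mat a' i0 j0 ⟨M, ⟨hM.1, fun m => ?_⟩, hI⟩
      obtain ⟨h1, h2⟩ := hM.2 m
      refine ⟨⟨(h1.1).resolve_left (hno m), h1.2⟩, h2.1, fun h => h2.2 ⟨Or.inr h.1, h.2⟩⟩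
    obtain ⟨m0, hm0⟩ := hex
    have haa : a' = a := huniq r _ _ (hm0 ▸ (hM.2 m0).1.2) hr4
    subst haa
    obtain ⟨x, y, Ms, hxM, hx, hy, hxs, hys, hMs, hMd⟩ := vo_match H i0 j0 M _ _
      (by rw [Set.disjoint_left]; intro v hv hv'; exact hv'.2 hv) hM hI
    have hi0 : i0 = i := by
      rw [← hr2, ← hm0, ← (hxM m0 m0.2).1]
      exact (hx m0 m0.2).2.1.symm
    subst hi0
    have hxB : ∀ m, m < k ^ 2 + k + 1 → x m ∈ B := by
      intro m hm
      rcases (hx m (by omega)).2.2.1 with h | h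
      · exfalso
        have h1 := hx (m + 1) (by omega)
        have h2 := hxs m (m + 1) (by omega) (by omega)
        rw [h] at h2
        rcases h1.2.2.1 with h3 | h3
        · rw [h3] at h2; omega
        · exact hr3 (I.mono r _ a' hr1 h1.1 (hr2.trans h1.2.1.symm) hr4 h1.2.2.2 h2 h3)
      · exact h
    have hyB : ∀ m, m < k ^ 2 + k + 2 → y m ∉ B := by
      intro m hm h
      exact (hy m hm).2.2.2 ⟨Or.inr h, (hy m hm).2.2.1⟩
    have hy0 := hy 0 (by omega)
    have hy0t : y 0 ∉ Set.range tv := by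
      rintro ⟨i', hi'⟩
      have h1 := hys 0 1 (by omega) (by omega)
      have h2 := H.ld.t_max (y 1) (hy 1 (by omega)).1
      rw [(hy 1 (by omega)).2.1] at h2
      have h3 : i' = j0 := by rw [← hy0.2.1, ← hi', H.ld.t_pth]
      rw [h3] at hi'
      rw [← hi'] at h1
      omega
    refine ⟨⟨j0, y 0, hy0.1, hy0.2.1, hyB 0 (by omega), hy0t, hy0.2.2.1⟩, x, y, Ms, ?_, ?_, ?_, ?_,
      ?_, ?_⟩
    · intro m hm
      have := hx m (by omega)
      exact ⟨this.1, this.2.1, hxB m hm, this.2.2.2⟩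
    · intro m hm
      have := hy m (by omega)
      exact ⟨this.1, this.2.1, hyB m (by omega), this.2.2.1⟩
    · intro m m' h h'; exact hxs m m' h (by omega)
    · intro m m' h h'; exact hys m m' h (by omega)
    · intro m hm; exact hMs m (by omega)
    · intro m m' hm hm' hne; exact hMd m m' (by omega) (by omega) hne
  choose f x y Ms h1 h2 h3 h4 h5 h6 using hstep
  obtain ⟨t, ht1, htk, φ, ι, hφ, hι, hιf⟩ := vo_cycle f
  have hcard : Fintype.card α ≤ k := by
    have := Fintype.card_subtype_le (α := Fin k)
      (fun i => ∃ v ∈ linkSupport L, pth v = i ∧ v ∉ B ∧ v ∉ Set.range tv ∧ v ∈ C a)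
    rwa [Fintype.card_fin] at this
  refine H.ld.clique_rot ht1 (htk.trans hcard) φ hφ (fun j => (ι j).1)
    (fun p q h => hι (Subtype.ext h)) (fun j => x (ι j)) (fun j => y (ι j)) (fun j => Ms (ι j))
    B (C a) (hpart.1 a) (fun j => h1 (ι j)) ?_ (fun j => h3 (ι j)) (fun j => h4 (ι j))
    (fun j => h5 (ι j)) (fun j => h6 (ι j)) ?_
  · intro j m hm
    rw [hιf]
    exact h2 (ι j) m hm
  · intro u v hu hv h hua hva huB hvB
    exact I.lt H hu hv h hua hva huB hvB

theorem vo_ext (hpart : G.IsCliquePartition C) (H : LC L sv tv pth pos)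
    (I : VInv L sv tv C pth pos B) 
    (hinc : ∃ v ∈ linkSupport L, v ∉ B ∧ v ∉ Set.range tv) :
    ∃ r ∈ linkSupport L, r ∉ B ∧ r ∉ Set.range tv ∧ VInv L sv tv C pth pos (insert r B) := by
  by_contra hcon
  push Not at hcon
  have huniq : ∀ v b b', v ∈ C b → v ∈ C b' → b = b' := fun v b b' h h' =>
    (hpart.2 v).unique h h'
  let α := {a : Fin c // ∃ v ∈ linkSupport L, v ∉ B ∧ v ∉ Set.range tv ∧ v ∈ C a}
  have hne : Nonempty α := by
    obtain ⟨v, h1, h2, h3⟩ := hinc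
    obtain ⟨a, ha, _⟩ := hpart.2 v
    exact ⟨⟨a, v, h1, h2, h3, ha⟩⟩
  have hc : 1 ≤ c := by
    obtain ⟨a⟩ := hne
    have := a.1.2
    omega
  have hz := vo_z_pos (k := k) hc
  have hstep : ∀ a : α, ∃ (b : α) (i : Fin k) (x y : ℕ → V),
      (∀ p < 2 * zOf k c, x p ∈ linkSupport L ∧ pth (x p) = i ∧ x p ∈ B ∧ x p ∈ C a.1) ∧
      (∀ p < 2 * zOf k c, y p ∈ linkSupport L ∧ pth (y p) = i ∧ y p ∉ B ∧ y p ∈ C b.1) ∧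
      (∀ p < 2 * zOf k c, pos (x p) < pos (y p)) ∧
      ∀ p p', p < p' → p' < 2 * zOf k c → pos (y p) < pos (x p') := by
    rintro ⟨a, ha⟩
    obtain ⟨r, hr1, hr2, hr3, hr4, hr5, hr6⟩ := vo_clique hpart H I a ha
    have hnot := hcon r hr1 hr2 hr3
    have hex : ∃ a' b, a' ≠ b ∧ ∃ i,
        FAlt (linkSupport L) pth pos i (insert r B ∩ C a') (C b \ insert r B)
          (2 * zOf k c + 1) := by
      by_contra hno
      push Not at hno
      refine hnot ⟨fun i => Or.inr (I.s i), ?_, ?_, ?_, hr6, hno⟩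
      · rintro v (rfl | hv)
        · exact hr1
        · exact I.sub hv
      · rintro i (h | h)
        · exact hr3 ⟨i, h⟩
        · exact I.t i h
      · rintro u v b hu hv huv hub hvb hlt (rfl | hvB)
        · have := huniq v _ _ hvb hr4
          subst this
          exact Or.inr (hr5 u hu huv hub hlt)
        · exact Or.inr (I.mono u v b hu hv huv hub hvb hlt hvB)
    obtain ⟨a', b, hab, i, x, y, hx, hy, hxy, hyx⟩ := hex
    have hex2 : ∃ p < 2 * zOf k c + 1, x p = r := by
      by_contra hno
      push Not at hno
      refine I.alt a' b hab i ⟨x, y, fun p hp => ?_, fun p hp => ?_, hxy, hyx⟩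
      · have := hx p hp
        exact ⟨this.1, this.2.1, this.2.2.1.resolve_left (hno p hp), this.2.2.2⟩
      · have := hy p hp
        exact ⟨this.1, this.2.1, this.2.2.1, fun h => this.2.2.2 (Or.inr h)⟩
    obtain ⟨p0, hp0, hp0r⟩ := hex2
    have haa : a' = a := huniq r _ _ (hp0r ▸ (hx p0 hp0).2.2.2) hr4
    subst haa
    have hir : pth r = i := hp0r ▸ (hx p0 hp0).2.1
    have hxB : ∀ p < 2 * zOf k c, x p ∈ B := by
      intro p hp
      rcases (hx p (by omega)).2.2.1 with h | h
      · exfalso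
        have h1 := hx (p + 1) (by omega)
        have h2 := (hxy p (by omega)).trans (hyx p (p + 1) (by omega) (by omega))
        rw [h] at h2
        rcases h1.2.2.1 with h3 | h3
        · rw [h3] at h2; omega
        · exact hr2 (I.mono r _ a' hr1 h1.1 (hir.trans h1.2.1.symm) hr4 h1.2.2.2 h2 h3)
      · exact h
    have hy0 := hy 0 (by omega)
    have hy0t : y 0 ∉ Set.range tv := by
      rintro ⟨i', hi'⟩
      have h1 := hyx 0 1 (by omega) (by omega)
      have h2 := H.ld.t_max (x 1) (hx 1 (by omega)).1
      rw [(hx 1 (by omega)).2.1] at h2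
      have h3 : i' = i := by rw [← hy0.2.1, ← hi', H.ld.t_pth]
      rw [h3] at hi'
      rw [← hi'] at h1
      omega
    refine ⟨⟨b, y 0, hy0.1, fun h => hy0.2.2.2 (Or.inr h), hy0t, hy0.2.2.1⟩, i, x, y, ?_, ?_, ?_, ?_⟩
    · intro p hp
      have := hx p (by omega)
      exact ⟨this.1, this.2.1, hxB p hp, this.2.2.2⟩
    · intro p hp
      have := hy p (by omega)
      exact ⟨this.1, this.2.1, fun h => this.2.2.2 (Or.inr h), this.2.2.1⟩
    · intro p hp; exact hxy p (by omega)
    · intro p p' h h'; exact hyx p p' h (by omega)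
  choose f q x y h1 h2 h3 h4 using hstep
  obtain ⟨n, hn1, hnc, φ, ι, hφ, hι, hιf⟩ := vo_cycle f
  have hcard : Fintype.card α ≤ c := by
    have := Fintype.card_subtype_le (α := Fin c)
      (fun a => ∃ v ∈ linkSupport L, v ∉ B ∧ v ∉ Set.range tv ∧ v ∈ C a)
    rwa [Fintype.card_fin] at this
  have hnc' : n ≤ c := hnc.trans hcard
  obtain ⟨w, hw, hw2⟩ : ∃ w, w = 2 * (c * (k ^ 2 + k + 1) + k + 2) ∧ 2 * zOf k c = c * w :=
    ⟨_, rfl, by unfold zOf; ring⟩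
  have hwpos : 0 < w := by omega
  have hblock : ∀ b p, b < n → p < w → b * w + p < 2 * zOf k c := by
    intro b p hb hp
    rw [hw2]
    have : (b + 1) * w ≤ c * w := Nat.mul_le_mul_right _ (by omega)
    rw [Nat.add_mul, Nat.one_mul] at this
    omega
  have hxle : ∀ a p p', p ≤ p' → p' < 2 * zOf k c → pos (x a p) ≤ pos (x a p') := by
    intro a p p' h h'
    rcases Nat.lt_or_ge p p' with h5 | h5
    · exact ((h3 a p (by omega)).trans (h4 a p p' h5 h')).le
    · rw [show p = p' by omega]
  obtain ⟨β, hβ1, hβ2⟩ := vo_sched n (Finset.univ : Finset (Fin n))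
    (fun j b => pos (x (ι j) (b * w))) (fun j b => pos (y (ι j) (b * w + (w - 1)))) (by simp)
    (by
      intro j _ b hb
      have := hblock b (w - 1) hb (by omega)
      exact (hxle (ι j) _ _ (by omega) this).trans (h3 (ι j) _ this).le)
    (by
      intro j _ b b' hb hb'
      have := hblock b' 0 hb' hwpos
      refine h4 (ι j) _ _ ?_ (by simpa using this)
      have : (b + 1) * w ≤ b' * w := Nat.mul_le_mul_right _ (by omega)
      rw [Nat.add_mul, Nat.one_mul] at this
      omega)
  have hβ1 : ∀ j, β j < n := fun j => hβ1 j (Finset.mem_univ _)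
  have hβ2 := fun j j' => hβ2 j (Finset.mem_univ _) j' (Finset.mem_univ _)
  let X : Fin n → ℕ → V := fun j p => x (ι j) (β j * w + p)
  let Y : Fin n → ℕ → V := fun j p => y (ι j) (β j * w + p)
  have hX : ∀ j p, p < w → X j p ∈ linkSupport L ∧ pth (X j p) = q (ι j) ∧ X j p ∈ B ∧
      X j p ∈ C (ι j).1 := fun j p hp => h1 (ι j) _ (hblock _ _ (hβ1 j) hp)
  have hY : ∀ j p, p < w → Y j p ∈ linkSupport L ∧ pth (Y j p) = q (ι j) ∧ Y j p ∉ B ∧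
      Y j p ∈ C (ι (φ j)).1 := fun j p hp => by
    rw [hιf]
    exact h2 (ι j) _ (hblock _ _ (hβ1 j) hp)
  have hXY : ∀ j p, p < w → pos (X j p) < pos (Y j p) := fun j p hp =>
    h3 (ι j) _ (hblock _ _ (hβ1 j) hp)
  have hYX : ∀ j p p', p < p' → p' < w → pos (Y j p) < pos (X j p') := fun j p p' h hp =>
    h4 (ι j) _ _ (by omega) (hblock _ _ (hβ1 j) hp)
  let bad : Fin n → Finset ℕ := fun j =>
    (Finset.range (w - 2)).filter fun p => ¬ G.adj (Y j p) (X (φ j) (p + 2))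
  have hbad : ∀ j, (bad j).card ≤ k ^ 2 + k + 1 := by
    intro j
    by_contra hlt
    obtain ⟨g, hg, hgs⟩ := vo_enum (bad j) (k ^ 2 + k + 2) (by omega)
    have hgw : ∀ r < k ^ 2 + k + 2, g r + 2 < w ∧ ¬ G.adj (Y j (g r)) (X (φ j) (g r + 2)) := by
      intro r hr
      have := Finset.mem_filter.1 (hg r hr)
      have h5 := Finset.mem_range.1 this.1
      exact ⟨by omega, this.2⟩
    refine I.mat (ι (φ j)).1 (q (ι (φ j))) (q (ι j)) (vo_mkmatch H _ _
      (fun r => X (φ j) (g r + 2)) (fun r => Y j (g r)) _ _ ?_ ?_ ?_ ?_ ?_ ?_)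
    · rw [Set.disjoint_left]; intro v hv hv'; exact hv'.2 hv
    · intro r hr
      have := hX (φ j) (g r + 2) (hgw r hr).1
      exact ⟨this.1, this.2.1, this.2.2.1, this.2.2.2⟩
    · intro r hr
      have h5 := (hgw r hr).1
      have := hY j (g r) (by omega)
      exact ⟨this.1, this.2.1, this.2.2.2, fun h => this.2.2.1 h.1⟩
    · intro r r' h h'
      have h5 := (hgw r' h').1
      have h6 := hgs r r' h h'
      exact (hXY (φ j) (g r + 2) (by omega)).trans (hYX (φ j) _ _ (by omega) h5)
    · intro r r' h h'
      have h5 := (hgw r' h').1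
      have h6 := hgs r r' h h'
      exact (hYX j _ _ h6 (by omega)).trans (hXY j _ (by omega))
    · intro r hr
      have h5 := hgw r hr
      have h6 := hX (φ j) (g r + 2) h5.1
      have h7 := hY j (g r) (by omega)
      exact (hpart.1 _ _ h6.2.2.2 _ h7.2.2.2 (fun h => h7.2.2.1 (h ▸ h6.2.2.1))).resolve_right h5.2
  let good := Finset.range (w - 2) \ Finset.univ.biUnion bad
  have hgood : 2 * n ≤ good.card := by
    have h5 : (Finset.univ.biUnion bad).card ≤ n * (k ^ 2 + k + 1) := by
      have := Finset.card_biUnion_le_card_mul Finset.univ bad (k ^ 2 + k + 1) (fun j _ => hbad j)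
      simpa using this
    have h6 := Finset.le_card_sdiff (Finset.univ.biUnion bad) (Finset.range (w - 2))
    rw [Finset.card_range] at h6
    have h7 : n * (k ^ 2 + k + 1) ≤ c * (k ^ 2 + k + 1) := Nat.mul_le_mul_right _ hnc'
    have hk : 1 ≤ k := by
      have := (q (ι ⟨0, hn1⟩)).2
      omega
    have h8 : c * 2 ≤ c * (k ^ 2 + k + 1) := Nat.mul_le_mul_left _ (by omega)
    change 2 * n ≤ (Finset.range (w - 2) \ Finset.univ.biUnion bad).card
    omega
  obtain ⟨g, hg, hgs⟩ := vo_enum good (2 * n) hgood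
  refine H.ld.path_rot hn1 φ hφ w (fun j => q (ι j)) X Y (fun j p hp => ⟨(hX j p hp).1, (hX j p hp).2.1⟩)
    (fun j p hp => ⟨(hY j p hp).1, (hY j p hp).2.1⟩) hXY hYX ?_ (fun r => g (2 * r)) ?_ ?_ ?_
  · intro j j' hne _
    exact hβ2 j j' hne
  · intro r hr
    have := Finset.mem_range.1 (Finset.mem_sdiff.1 (hg (2 * r) (by omega))).1
    omega
  · intro r hr
    have := hgs (2 * r) (2 * r + 1) (by omega) (by omega)
    have := hgs (2 * r + 1) (2 * (r + 1)) (by omega) (by omega)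
    omega
  · intro j r hr
    have h5 := Finset.mem_sdiff.1 (hg (2 * r) (by omega))
    by_contra h6
    exact h5.2 (Finset.mem_biUnion.2 ⟨j, Finset.mem_univ _, Finset.mem_filter.2 ⟨h5.1, h6⟩⟩)

end


section

variable {V : Type} [Fintype V] {G : Dgraph V} {k c : ℕ} {L : Fin k → Dpath G}
    {sv tv : Fin k → V} {pth : V → Fin k} {pos : V → ℕ} {C : Fin c → Set V} {B : Set V}

theorem vo_list (hpart : G.IsCliquePartition C) (H : LC L sv tv pth pos) : ∀ (N : ℕ) (B : Set V),
    VInv L sv tv C pth pos B → ((linkSupport L \ Set.range tv) \ B).ncard = N →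
    ∃ e : List V, e.Nodup ∧ (∀ v, v ∈ e ↔ v ∈ (linkSupport L \ Set.range tv) \ B) ∧
      ∀ h ≤ e.length, VInv L sv tv C pth pos (B ∪ {v | v ∈ e.take h}) := by
  intro N
  induction N with
  | zero =>
    intro B I hB
    rw [Set.ncard_eq_zero (Set.toFinite _)] at hB
    refine ⟨[], by simp, by simp [hB], ?_⟩
    intro h _
    simpa using I
  | succ N ih =>
    intro B I hB
    have hne : ((linkSupport L \ Set.range tv) \ B).Nonempty := by
      rw [← Set.ncard_pos (Set.toFinite _)]; omega
    obtain ⟨v, ⟨hv1, hv2⟩, hv3⟩ := hne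
    obtain ⟨r, hr1, hr2, hr3, I'⟩ := vo_ext hpart H I ⟨v, hv1, hv3, hv2⟩
    have heq : (linkSupport L \ Set.range tv) \ insert r B =
        ((linkSupport L \ Set.range tv) \ B) \ {r} := by
      ext u
      simp only [Set.mem_sdiff, Set.mem_insert_iff, Set.mem_singleton_iff]
      tauto
    obtain ⟨e, he1, he2, he3⟩ := ih (insert r B) I' (by
      have hrm : r ∈ (linkSupport L \ Set.range tv) \ B := ⟨⟨hr1, hr3⟩, hr2⟩
      rw [heq]
      have := Set.ncard_sdiff_singleton_add_one hrm
      omega)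
    refine ⟨r :: e, ?_, ?_, ?_⟩
    · rw [List.nodup_cons]
      refine ⟨fun h => ?_, he1⟩
      exact ((he2 r).1 h).2 (Or.inl rfl)
    · intro u
      rw [List.mem_cons, he2, heq]
      constructor
      · rintro (rfl | h)
        · exact ⟨⟨hr1, hr3⟩, hr2⟩
        · exact h.1
      · intro h
        by_cases hur : u = r
        · exact Or.inl hur
        · exact Or.inr ⟨h, hur⟩
    · intro h hh
      rcases h with _ | h
      · simpa using I
      · have := he3 h (by simpa using hh)
        have heq2 : B ∪ {v | v ∈ (r :: e).take (h + 1)} = insert r B ∪ {v | v ∈ e.take h} := by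
          ext u
          simp [List.take_succ_cons]
          tauto
        rw [heq2]
        exact this

theorem vo_accept (H : LC L sv tv pth pos) (I : VInv L sv tv C pth pos B) (a : Fin c) :
    CAcceptable sv tv L (C a) (B ∩ C a) := by
  refine ⟨Set.inter_subset_right, ?_, ?_, ?_, I.mat a⟩
  · rintro _ ⟨⟨i, rfl⟩, h⟩
    exact ⟨I.s i, h⟩
  · rw [Set.eq_empty_iff_forall_notMem]
    rintro _ ⟨⟨i, rfl⟩, h⟩
    exact I.t i h.1
  · intro i
    have hp : ∃ p, ∀ v ∈ (L i).verts, v ∈ C a → (pos v ≤ p ↔ v ∈ B) := by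
      let S : Set V := {v | v ∈ (L i).verts ∧ v ∈ C a ∧ v ∈ B}
      by_cases hS : S.Nonempty
      · obtain ⟨u, ⟨hu1, hu2, hu3⟩, humax⟩ := Set.exists_max_image S pos (Set.toFinite _) hS
        refine ⟨pos u, fun v hv hva => ⟨fun hle => ?_, fun hvB => humax v ⟨hv, hva, hvB⟩⟩⟩
        have hu4 := (H.mem u i).1 hu1
        have hv4 := (H.mem v i).1 hv
        by_contra hvB
        have := I.lt H hu4.1 hv4.1 (hu4.2.trans hv4.2.symm) hu2 hva hu3 hvB
        omega
      · refine ⟨0, fun v hv hva => ⟨fun hle => ?_, fun hvB => absurd ⟨v, hv, hva, hvB⟩ hS⟩⟩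
        have hv4 := (H.mem v i).1 hv
        have : v = sv i := H.ld.inj v hv4.1 _ (H.ld.s_on i) (hv4.2.trans (H.ld.s_pth i).symm)
          (by rw [H.ld.s_pos]; omega)
        rw [this]
        exact I.s i
    obtain ⟨p, hp⟩ := hp
    have hpre : (L i).verts.take (p + 1) <+: (L i).verts := ⟨_, List.take_append_drop _ _⟩
    refine ⟨⟨(L i).verts.take (p + 1), ?_, (L i).nodup.sublist hpre.sublist,
      vo_chain_init (L i).chain hpre⟩, hpre, ?_⟩
    · have := (L i).ne
      simpa using this
    · have hm : ∀ v ∈ (L i).verts, v ∈ (L i).verts.take (p + 1) ↔ pos v ≤ p := by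
        intro v hv
        rw [List.mem_take_iff_idxOf_lt hv, ← H.idx v i hv]
        omega
      ext v
      constructor
      · rintro ⟨h1, h2⟩
        have hv : v ∈ (L i).verts := hpre.subset h1
        exact ⟨hv, (hp v hv h2).1 ((hm v hv).1 h1), h2⟩
      · rintro ⟨h1, h2, h3⟩
        exact ⟨(hm v h1).2 ((hp v h1 h3).2 h2), h3⟩

theorem vo_falt (H : LC L sv tv pth pos) {i : Fin k} {X Y : Set V} {m : ℕ}
    (h : HasAlt (L i) X Y m) : FAlt (linkSupport L) pth pos i X Y m := by
  obtain ⟨l, hl, hlen, halt⟩ := h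
  obtain ⟨h1, h2⟩ := (H.sub i l).1 hl
  rw [List.pairwise_iff_getElem] at h2
  refine ⟨fun p => if h : 2 * p < l.length then l[2 * p] else sv i,
    fun p => if h : 2 * p + 1 < l.length then l[2 * p + 1] else sv i, ?_, ?_, ?_, ?_⟩
  · intro p hp
    have hlt : 2 * p < l.length := by omega
    simp only [hlt, dif_pos]
    have h3 := h1 _ (List.getElem_mem hlt)
    have h4 := halt (2 * p) hlt
    rw [if_pos (by omega)] at h4
    exact ⟨h3.1, h3.2, h4⟩
  · intro p hp
    have hlt : 2 * p + 1 < l.length := by omega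
    simp only [hlt, dif_pos]
    have h3 := h1 _ (List.getElem_mem hlt)
    have h4 := halt (2 * p + 1) hlt
    rw [if_neg (by omega)] at h4
    exact ⟨h3.1, h3.2, h4⟩
  · intro p hp
    have hlt : 2 * p < l.length := by omega
    have hlt' : 2 * p + 1 < l.length := by omega
    simp only [hlt, hlt', dif_pos]
    exact h2 _ _ hlt hlt' (by omega)
  · intro p p' hpp hp'
    have hlt : 2 * p + 1 < l.length := by omega
    have hlt' : 2 * p' < l.length := by omega
    simp only [hlt, hlt', dif_pos]
    exact h2 _ _ hlt hlt' (by omega)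

theorem vo_wiggle (hc : 1 ≤ c) (hpart : G.IsCliquePartition C) (H : LC L sv tv pth pos)
    (I : VInv L sv tv C pth pos B) (i : Fin k) :
    wiggle (L i) B (linkSupport L \ B) ≤ c * (c - 1) * (zOf k c + 1) + 1 := by
  have hz := vo_z_pos (k := k) hc
  apply csSup_le
  · exact ⟨0, [], by simp, by simp, by intro j hj; simp at hj⟩
  intro m hm
  obtain ⟨x, y, hx, hy, hxy, hyx⟩ := vo_falt H hm
  have hcl : ∀ v, ∃ a, v ∈ C a := fun v => (hpart.2 v).exists
  choose cl hcl using hcl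
  let T : Fin c → Fin c → Finset ℕ := fun a b =>
    (Finset.range m).filter fun p => cl (x p) = a ∧ cl (y p) = b
  have hT : ∀ a b p, p ∈ T a b → p < m ∧ x p ∈ C a ∧ y p ∈ C b := by
    intro a b p hp
    have := Finset.mem_filter.1 hp
    exact ⟨Finset.mem_range.1 this.1, this.2.1 ▸ hcl _, this.2.2 ▸ hcl _⟩
  have huniq : ∀ v b b', v ∈ C b → v ∈ C b' → b = b' := fun v b b' h h' =>
    (hpart.2 v).unique h h'
  have hlt : ∀ p p' a, p < m → p' < m → x p ∈ C a → y p' ∈ C a → pos (x p) < pos (y p') := by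
    intro p p' a hp hp' h h'
    have h1 := hx p hp
    have h2 := hy p' hp'
    exact I.lt H h1.1 h2.1 (h1.2.1.trans h2.2.1.symm) h h' h1.2.2 h2.2.2.2
  have hdiag : ∀ a, (T a a).card ≤ 1 := by
    intro a
    rw [Finset.card_le_one]
    intro p hp p' hp'
    obtain ⟨h1, h2, h3⟩ := hT a a p hp
    obtain ⟨h1', h2', h3'⟩ := hT a a p' hp'
    rcases lt_trichotomy p p' with h | h | h
    · have h5 := hyx p p' h h1'
      have h6 := hlt p' p a h1' h1 h2' h3
      omega
    · exact h
    · have h5 := hyx p' p h h1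
      have h6 := hlt p p' a h1 h1' h2 h3'
      omega
  have hoff : ∀ a b, a ≠ b → (T a b).card ≤ 2 * zOf k c := by
    intro a b hab
    by_contra hcon
    obtain ⟨g, hg, hgs⟩ := vo_enum (T a b) (2 * zOf k c + 1) (by omega)
    refine I.alt a b hab i ⟨fun r => x (g r), fun r => y (g r), ?_, ?_, ?_, ?_⟩
    · intro r hr
      obtain ⟨h1, h2, h3⟩ := hT a b _ (hg r hr)
      have := hx _ h1
      exact ⟨this.1, this.2.1, this.2.2, h2⟩
    · intro r hr
      obtain ⟨h1, h2, h3⟩ := hT a b _ (hg r hr)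
      have := hy _ h1
      exact ⟨this.1, this.2.1, h3, this.2.2.2⟩
    · intro r hr
      exact hxy _ (hT a b _ (hg r hr)).1
    · intro r r' h h'
      exact hyx _ _ (hgs r r' h h') (hT a b _ (hg r' h')).1
  have hzero : ∀ a b, a ≠ b → 2 ≤ (T a b).card → (T b a).card = 0 := by
    intro a b hab h2
    rw [Finset.card_eq_zero, Finset.eq_empty_iff_forall_notMem]
    intro p hp
    obtain ⟨g, hg, hgs⟩ := vo_enum (T a b) 2 h2
    obtain ⟨a1, a2, a3⟩ := hT a b _ (hg 0 (by omega))
    obtain ⟨b1, b2, b3⟩ := hT a b _ (hg 1 (by omega))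
    obtain ⟨p1, p2, p3⟩ := hT b a _ hp
    have h3 := hyx _ _ (hgs 0 1 (by omega) (by omega)) b1
    have h4 := hlt p (g 0) b p1 a1 p2 a3
    have h5 := hlt (g 1) p a b1 p1 b2 p3
    rcases lt_trichotomy p (g 0) with h | h | h
    · have h6 := hyx p (g 0) h a1
      have h7 := hxy (g 0) a1
      omega
    · rw [h] at p2
      exact hab (huniq _ _ _ a2 p2)
    · have h6 := hyx (g 0) p h p1
      omega
  have hpair : ∀ a b, (T a b).card + (T b a).card ≤ if a = b then 2 else 2 * zOf k c := by
    intro a b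
    split_ifs with h
    · subst h
      have := hdiag a
      omega
    · have h1 := hoff a b h
      have h2 := hoff b a (Ne.symm h)
      have h3 := hzero a b h
      have h4 := hzero b a (Ne.symm h)
      by_cases h5 : 2 ≤ (T a b).card
      · have := h3 h5; omega
      · by_cases h6 : 2 ≤ (T b a).card
        · have := h4 h6; omega
        · omega
  have hsum : m = ∑ a, ∑ b, (T a b).card := by
    have h1 := Finset.card_eq_sum_card_fiberwise (s := Finset.range m)
      (t := (Finset.univ : Finset (Fin c × Fin c))) (f := fun p => (cl (x p), cl (y p)))
      (by intro p _; simp)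
    rw [Finset.card_range, Fintype.sum_prod_type] at h1
    rw [h1]
    refine Finset.sum_congr rfl fun a _ => Finset.sum_congr rfl fun b _ => ?_
    simp only [T, Prod.mk.injEq]
  have hsum2 : m + m = ∑ a, ∑ b, ((T a b).card + (T b a).card) := by
    simp only [Finset.sum_add_distrib]
    rw [Finset.sum_comm (f := fun a b => (T b a).card), ← hsum]
  have hle : m + m ≤ ∑ a : Fin c, ∑ b : Fin c, if a = b then 2 else 2 * zOf k c := by
    rw [hsum2]
    exact Finset.sum_le_sum fun a _ => Finset.sum_le_sum fun b _ => hpair a b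
  have hcomp : ∑ a : Fin c, ∑ b : Fin c, (if a = b then 2 else 2 * zOf k c)
      = c * (2 + (c - 1) * (2 * zOf k c)) := by
    have : ∀ a : Fin c, ∑ b : Fin c, (if a = b then 2 else 2 * zOf k c)
        = 2 + (c - 1) * (2 * zOf k c) := by
      intro a
      rw [← Finset.add_sum_erase _ _ (Finset.mem_univ a), if_pos rfl]
      congr 1
      rw [Finset.sum_congr rfl (g := fun _ => 2 * zOf k c) (by
        intro b hb
        rw [if_neg (Ne.symm (Finset.ne_of_mem_erase hb))])]
      simp
    simp only [this]
    simp
  rw [hcomp] at hle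
  obtain ⟨d, rfl⟩ : ∃ d, c = d + 1 := ⟨c - 1, by omega⟩
  simp only [Nat.add_sub_cancel] at *
  nlinarith [Nat.zero_le (d * d)]

end

/-- Theorem 3.4 (the key lemma): there is an enumeration of
`V(L) ∖ {s 1,…,s k,t 1,…,t k}` all of whose prefixes give `C a`-acceptable sets and
bounded `(B,A)`-wiggle numbers. -/
theorem vertex_order {V : Type} [Fintype V] {k c : ℕ} (hk : 1 ≤ k) (hc : 1 ≤ c)
    (G : Dgraph V) (sv tv : Fin k → V) (hinst : IsInstance sv tv)
    (C : Fin c → Set V) (hpart : G.IsCliquePartition C)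
    (L : Fin k → Dpath G) (hL : IsMinimumLinkageFor L sv tv) :
    ∃ e : List V, IsEnumeration L sv tv e ∧
      ∀ h ≤ e.length,
        (∀ a, CAcceptable sv tv L (C a) (BsetOf sv e h ∩ C a)) ∧
        ∀ i, wiggle (L i) (BsetOf sv e h) (AsetOf L sv e h) ≤
          c * (c - 1) * (zOf k c + 1) + 1 := by
  obtain ⟨pth, pos, H⟩ := vo_LC hk G sv tv L hL
  obtain ⟨e, he1, he2, he3⟩ := vo_list hpart H _ _ (VInv.base (C := C) hc hinst H) rfl
  refine ⟨e, ⟨he1, ?_⟩, ?_⟩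
  · ext v
    have := he2 v
    simp only [Set.mem_sdiff, Set.mem_union] at this ⊢
    change v ∈ e ↔ _
    rw [this]
    tauto
  · intro h hh
    exact ⟨fun a => vo_accept H (he3 h hh) a, fun i => vo_wiggle hc hpart H (he3 h hh) i⟩
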